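/- Let r > 1 and s = (s_1, …, s_r) ∈ ℤ^r with all s_i < 0. Then ζ(s) = 0 if and only if there exists some 1 ≤ i ≤ r − 1 such that r − i > L_{−s_i}. -/

import Mathlib

open Polynomial

/-- The power sum `S_d(-k) = ∑_{a monic, deg a = d} a^k`, written as a sum over the
lower-order coefficients of the monic polynomial. -/
noncomputable def powerSum (Fq : Type) [Field Fq] [Fintype Fq] (d k : ℕ) : Polynomial Fq :=
  ∑ c : Fin d → Fq, (X ^ d + ∑ i : Fin d, C (c i) * X ^ (i : ℕ)) ^ k

/-- `m` sums to `k` with no carrying of digits in base `p`. -/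
def NoCarry (p : ℕ) {n : ℕ} (m : Fin n → ℕ) (k : ℕ) : Prop :=
  (∑ i, m i) = k ∧ ∀ j : ℕ, (∑ i, m i / p ^ j % p) = k / p ^ j % p

/-- The set `U_d(k)`. -/
def Uset (p q d k : ℕ) : Set (Fin (d + 1) → ℕ) :=
  {m | NoCarry p m k ∧ ∀ i : Fin (d + 1), 0 < (i : ℕ) → 0 < m i ∧ (q - 1) ∣ m i}

/-- The weight of an element of `U_d(k)`. -/
def wtU {d : ℕ} (m : Fin (d + 1) → ℕ) : ℕ :=
  ∑ i : Fin (d + 1), (d - (i : ℕ)) * m i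

/-- Strict lexicographic order on tuples. -/
def LexLT {n : ℕ} (x y : Fin n → ℕ) : Prop :=
  ∃ i, (∀ j, j < i → x j = y j) ∧ x i < y i

/-- Lexicographic order on tuples. -/
def LexLE {n : ℕ} (x y : Fin n → ℕ) : Prop := x = y ∨ LexLT x y

/-- `L_k := min_{0 ≤ i < f} l(k p^i)/(q-1)` where `l` is the base-`q` digit sum, `q = p^f`. -/
noncomputable def Lval (p f k : ℕ) (hf : 0 < f) : ℚ :=
  (Finset.range f).inf' ⟨0, Finset.mem_range.mpr hf⟩
    (fun i => ((Nat.digits (p ^ f) (k * p ^ i)).sum : ℚ) / ((p : ℚ) ^ f - 1))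

/-- The set `W_d(N)` of compositions. -/
def Wset (p q d N : ℕ) : Set (Fin d → ℕ) :=
  {Y | NoCarry p Y N ∧ ∀ i : Fin d, (i : ℕ) + 1 < d → 0 < Y i ∧ (q - 1) ∣ Y i}

/-- The weight of a composition. -/
def wtW {d : ℕ} (Y : Fin d → ℕ) : ℕ := ∑ i : Fin d, ((i : ℕ) + 1) * Y i

/-- `X` is the modest (lexicographically largest) composition in `W_d(N)`. -/
def Modest (p q : ℕ) {d : ℕ} (N : ℕ) (X : Fin d → ℕ) : Prop :=
  X ∈ Wset p q d N ∧ ∀ Y ∈ Wset p q d N, LexLE Y X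

/-- `X` is an optimal (minimum weight) composition in `W_d(N)`. -/
def Optimal (p q : ℕ) {d : ℕ} (N : ℕ) (X : Fin d → ℕ) : Prop :=
  X ∈ Wset p q d N ∧ ∀ Y ∈ Wset p q d N, wtW X ≤ wtW Y

/-- `Γ(n) : Fin f → ℕ`, summing the base-`p` digits of `n` in each residue class mod `f`. -/
def Gamma (p f n : ℕ) : Fin f → ℕ :=
  fun i => ∑ j ∈ Finset.range (Nat.log p n + 1), if j % f = (i : ℕ) then n / p ^ j % p else 0

/-- The cyclic matrix `E`, as a map: `(E x)_i = p x_{i+1} - x_i`, indices mod `f`. -/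
def Emap (p : ℕ) {R : Type} [Ring R] {f : ℕ} (x : Fin f → R) : Fin f → R :=
  fun i => (p : R) * x ⟨((i : ℕ) + 1) % f, Nat.mod_lt _ i.pos⟩ - x i

/-- `𝔍 = {Γ(n) : n > 0 is q-even}`, where `q = p ^ f`. -/
def Jfrak (p f : ℕ) : Set (Fin f → ℕ) :=
  {w | ∃ n : ℕ, 0 < n ∧ (p ^ f - 1) ∣ n ∧ Gamma p f n = w}

/-- `I_d`. -/
def Iset (p f d : ℕ) : Set (Fin f → ℕ) :=
  {u | (∃ n : ℕ, 0 < n ∧ Gamma p f n = u) ∧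
    ∃ v : Fin (d - 1) → Fin f → ℕ, (∀ j, v j ∈ Jfrak p f) ∧ (∑ j, v j) < u}

/-- `J_d`. -/
def Jset (p f d : ℕ) : Set (Fin f → ℕ) :=
  if d = 0 then ∅ else Jfrak p f ∩ (Iset p f d \ Iset p f (d + 1))

/-- A composition is `τ`-monotonic. -/
def TauMonotonic (p f : ℕ) {d : ℕ} (X : Fin d → ℕ) : Prop :=
  ∀ i j : Fin d, i < j → ∀ m n : ℕ, X i / p ^ m % p ≠ 0 → X j / p ^ n % p ≠ 0 →
    m % f = n % f → n ≤ m

/-- `W_d^B(N)`: compositions in `W_d(N)` whose `Γ`-matrix is `B`. -/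
def WBset (p f d N : ℕ) (B : Fin d → Fin f → ℕ) : Set (Fin d → ℕ) :=
  {Y | Y ∈ Wset p (p ^ f) d N ∧ ∀ j, Gamma p f (Y j) = B j}

/-- The multizeta value `ζ(-k_1, …, -k_r)` as a (finite) sum over strictly
decreasing tuples of degrees. -/
noncomputable def multizeta (Fq : Type) [Field Fq] [Fintype Fq] {r : ℕ} (k : Fin r → ℕ) :
    Polynomial Fq :=
  ∑ᶠ (dt : Fin r → ℕ) (_ : StrictAnti dt), ∏ i, powerSum Fq (dt i) (k i)

namespace MZ

/-- abstract digit data -/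
structure Dat (p : ℤ) (f M : ℕ) (N : ℕ → ℤ) : Prop where
  hp : 2 ≤ p
  hf : 0 < f
  hM : ∀ e, M ≤ e → N e = 0
  lo : ∀ e, N (e + f) ≤ N e
  hi : ∀ e, N e ≤ N (e + f) + (p - 1)

def Phi (p : ℤ) (f M : ℕ) (g : ℕ → ℤ) : ℤ :=
  ∑ e ∈ Finset.range M, p ^ e * (g e - g (e + f))

def EE (p : ℤ) {f : ℕ} (y : ZMod f → ℤ) : ZMod f → ℤ := fun i => p * y (i + 1) - y i

def TT (p : ℤ) (f M : ℕ) (N : ℕ → ℤ) (v : ZMod f → ℤ) : ℤ :=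
  Phi p f M (fun e => min (v e) (N e))

theorem exists_max_int {α : Type*} (P : α → Prop) (F : α → ℤ) (B : ℤ) (h : ∃ a, P a)
    (hB : ∀ a, P a → F a ≤ B) : ∃ a, P a ∧ ∀ b, P b → F b ≤ F a := by
  obtain ⟨ub, ⟨a, ha, rfl⟩, h2⟩ := Int.exists_greatest_of_bdd (P := fun z => ∃ a, P a ∧ F a = z)
    ⟨B, fun z ⟨a, ha, hz⟩ => hz ▸ hB a ha⟩ (by obtain ⟨a, ha⟩ := h; exact ⟨F a, a, ha, rfl⟩)
  exact ⟨a, ha, fun b hb => h2 _ ⟨b, hb, rfl⟩⟩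

theorem N_nonneg {p : ℤ} {f M : ℕ} {N : ℕ → ℤ} (h : Dat p f M N) (e : ℕ) : 0 ≤ N e := by
  have key : ∀ k e, M ≤ e + k → 0 ≤ N e := by
    intro k
    induction k with
    | zero => intro e he; rw [h.hM e (by omega)]
    | succ k ih =>
      intro e he
      have h1 := ih (e + f) (by have := h.hf; omega)
      have h2 := h.lo e
      omega
  exact key M e (by omega)

theorem Phi_nonneg {p : ℤ} {f M : ℕ} (hp : 1 ≤ p) (g : ℕ → ℤ) (g0 : ∀ e, 0 ≤ g e)
    (gM : ∀ e, M ≤ e → g e = 0) : 0 ≤ Phi p f M g := by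
  unfold Phi
  simp only [mul_sub, Finset.sum_sub_distrib, sub_nonneg]
  have h1 : ∑ e ∈ Finset.range M, p ^ e * g (e + f) ≤
      ∑ e ∈ Finset.range M, p ^ (f + e) * g (f + e) := by
    apply Finset.sum_le_sum
    intro e _
    rw [add_comm f e]
    apply mul_le_mul_of_nonneg_right _ (g0 _)
    exact pow_le_pow_right₀ hp (by omega)
  have h2 : ∑ e ∈ Finset.range (f + M), p ^ e * g e =
      ∑ e ∈ Finset.range f, p ^ e * g e + ∑ e ∈ Finset.range M, p ^ (f + e) * g (f + e) :=
    Finset.sum_range_add (fun e => p ^ e * g e) f M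
  have h3 : ∑ e ∈ Finset.range (M + f), p ^ e * g e =
      ∑ e ∈ Finset.range M, p ^ e * g e + ∑ e ∈ Finset.range f, p ^ (M + e) * g (M + e) :=
    Finset.sum_range_add (fun e => p ^ e * g e) M f
  have h4 : ∑ e ∈ Finset.range f, p ^ (M + e) * g (M + e) = 0 :=
    Finset.sum_eq_zero (fun e _ => by rw [gM _ (by omega), mul_zero])
  have h5 : 0 ≤ ∑ e ∈ Finset.range f, p ^ e * g e :=
    Finset.sum_nonneg (fun e _ => mul_nonneg (by positivity) (g0 _))
  rw [add_comm M f] at h3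
  linarith

theorem Phi_add {p : ℤ} {f M : ℕ} (g h : ℕ → ℤ) :
    Phi p f M (fun e => g e + h e) = Phi p f M g + Phi p f M h := by
  unfold Phi
  rw [← Finset.sum_add_distrib]
  exact Finset.sum_congr rfl (fun e _ => by ring)

theorem Phi_sub {p : ℤ} {f M : ℕ} (g h : ℕ → ℤ) :
    Phi p f M (fun e => g e - h e) = Phi p f M g - Phi p f M h := by
  unfold Phi
  rw [← Finset.sum_sub_distrib]
  exact Finset.sum_congr rfl (fun e _ => by ring)

theorem Phi_smul {p : ℤ} {f M : ℕ} (c : ℤ) (g : ℕ → ℤ) :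
    Phi p f M (fun e => c * g e) = c * Phi p f M g := by
  unfold Phi
  rw [Finset.mul_sum]
  exact Finset.sum_congr rfl (fun e _ => by ring)

theorem Phi_mono {p : ℤ} {f M : ℕ} (hp : 1 ≤ p) (g h : ℕ → ℤ) (gh : ∀ e, g e ≤ h e)
    (gM : ∀ e, M ≤ e → g e = h e) : Phi p f M g ≤ Phi p f M h := by
  have := Phi_nonneg (f := f) (M := M) hp (fun e => h e - g e) (fun e => by linarith [gh e])
    (fun e he => by simp [gM e he])
  rw [Phi_sub] at this
  linarith

theorem Phi_split {p : ℤ} {f M : ℕ} (hf : 0 < f) (g : ℕ → ℤ) (e : ℕ) (he : e < M)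
    (h0 : ∀ e', e < e' → g e' = 0) :
    Phi p f M g = p ^ e * g e + ∑ k ∈ Finset.range e, p ^ k * (g k - g (k + f)) := by
  unfold Phi
  have : M = e + 1 + (M - e - 1) := by omega
  rw [this, Finset.sum_range_add, Finset.sum_range_succ, h0 (e + f) (by omega)]
  have : ∑ k ∈ Finset.range (M - e - 1), p ^ (e + 1 + k) * (g (e + 1 + k) - g (e + 1 + k + f)) = 0 :=
    Finset.sum_eq_zero (fun k _ => by rw [h0 _ (by omega), h0 _ (by omega)]; simp)
  rw [this]; ring

theorem Phi_shift {p : ℤ} {f M : ℕ} (hp : 1 ≤ p) (g : ℕ → ℤ) (gd : ∀ e, g (e + f) ≤ g e)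
    (gM : ∀ e, M ≤ e → g e = 0) :
    p ^ f * Phi p f M (fun e => g (e + f)) ≤ Phi p f M g := by
  have h2 : ∑ e ∈ Finset.range (f + M), p ^ e * (g e - g (e + f)) =
      ∑ e ∈ Finset.range f, p ^ e * (g e - g (e + f)) +
      ∑ e ∈ Finset.range M, p ^ (f + e) * (g (f + e) - g (f + e + f)) :=
    Finset.sum_range_add _ f M
  have h3 : ∑ e ∈ Finset.range (M + f), p ^ e * (g e - g (e + f)) =
      ∑ e ∈ Finset.range M, p ^ e * (g e - g (e + f)) +
      ∑ e ∈ Finset.range f, p ^ (M + e) * (g (M + e) - g (M + e + f)) :=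
    Finset.sum_range_add _ M f
  have h4 : ∑ e ∈ Finset.range f, p ^ (M + e) * (g (M + e) - g (M + e + f)) = 0 :=
    Finset.sum_eq_zero (fun e _ => by rw [gM _ (by omega), gM _ (by omega)]; simp)
  have h5 : 0 ≤ ∑ e ∈ Finset.range f, p ^ e * (g e - g (e + f)) :=
    Finset.sum_nonneg (fun e _ => mul_nonneg (by positivity) (by linarith [gd e]))
  rw [add_comm M f] at h3
  unfold Phi
  rw [Finset.mul_sum]
  have h6 : ∑ e ∈ Finset.range M, p ^ f * (p ^ e * (g (e + f) - g (e + f + f))) =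
     ∑ e ∈ Finset.range M, p ^ (f + e) * (g (f + e) - g (f + e + f)) :=
    Finset.sum_congr rfl (fun e _ => by rw [add_comm f e, pow_add]; ring)
  linarith

theorem geom_low {p : ℤ} (e : ℕ) : ∑ k ∈ Finset.range e, p ^ k * (p - 1) = p ^ e - 1 := by
  induction e with
  | zero => simp
  | succ e ih => rw [Finset.sum_range_succ, ih, pow_succ]; ring

theorem T_concave {p : ℤ} {f M : ℕ} {N : ℕ → ℤ} (h : Dat p f M N) (a b c d : ZMod f → ℤ)
    (hs : ∀ i, c i + d i = a i + b i) (hc : ∀ i, min (a i) (b i) ≤ c i)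
    (hd : ∀ i, min (a i) (b i) ≤ d i) (a0 : ∀ i, 0 ≤ a i) (b0 : ∀ i, 0 ≤ b i) :
    TT p f M N a + TT p f M N b ≤ TT p f M N c + TT p f M N d := by
  unfold TT
  rw [← Phi_add, ← Phi_add]
  apply Phi_mono (by linarith [h.hp])
  · intro e
    have := hs e; have := hc e; have := hd e
    omega
  · intro e he
    have := hs e; have := hc e; have := hd e; have := h.hM e he
    have := a0 e; have := b0 e
    omega

/-- lexicographic comparison -/
theorem T_lex {p : ℤ} {f M : ℕ} {N : ℕ → ℤ} (h : Dat p f M N) (a b : ZMod f → ℤ)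
    (e : ℕ) (he : e < M) (heq : ∀ e' : ℕ, e < e' → min (a e') (N e') = min (b e') (N e'))
    (hlt : min (b e) (N e) < min (a e) (N e)) : TT p f M N b < TT p f M N a := by
  unfold TT
  rw [← sub_pos, ← Phi_sub, Phi_split h.hf _ e he (fun e' he' => by simp [heq e' he'])]
  have hp := h.hp
  have h1 : p ^ e * 1 ≤ p ^ e * (min (a e) (N e) - min (b e) (N e)) := by
    apply mul_le_mul_of_nonneg_left (by omega) (by positivity)
  have h2 : - ∑ k ∈ Finset.range e, p ^ k * (p - 1) ≤ ∑ k ∈ Finset.range e, p ^ k *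
      (min (a k) (N k) - min (b k) (N k) - (min (a (k + f : ℕ)) (N (k + f))
        - min (b (k + f : ℕ)) (N (k + f)))) := by
    rw [← Finset.sum_neg_distrib]
    apply Finset.sum_le_sum
    intro k _
    rw [← mul_neg]
    apply mul_le_mul_of_nonneg_left _ (by positivity)
    have := h.lo k; have := h.hi k
    simp only [Nat.cast_add, CharP.cast_eq_zero, add_zero]
    omega
  rw [geom_low] at h2
  linarith

end MZ

namespace MZ

def Good (p : ℤ) {f : ℕ} (N : ℕ → ℤ) (y : ZMod f → ℤ) : Prop :=
  ∀ i, 0 ≤ EE p y i ∧ EE p y i ≤ N i.val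

theorem EE_nonneg {p : ℤ} {f : ℕ} [NeZero f] (hp : 2 ≤ p) (y : ZMod f → ℤ)
    (h : ∀ i, 0 ≤ EE p y i) : ∀ i, 0 ≤ y i := by
  obtain ⟨j, -, hj⟩ := Finset.exists_min_image Finset.univ y ⟨0, Finset.mem_univ _⟩
  have h1 := h (j - 1)
  have h2 := hj (j - 1) (Finset.mem_univ _)
  simp only [EE, sub_add_cancel] at h1
  have : 0 ≤ y j := by nlinarith
  intro i
  exact this.trans (hj i (Finset.mem_univ _))

theorem EE_add {p : ℤ} {f : ℕ} (y z : ZMod f → ℤ) (i : ZMod f) :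
    EE p (fun j => y j + z j) i = EE p y i + EE p z i := by
  simp only [EE]; ring

theorem EE_sub {p : ℤ} {f : ℕ} (y z : ZMod f → ℤ) (i : ZMod f) :
    EE p (fun j => y j - z j) i = EE p y i - EE p z i := by
  simp only [EE]; ring

theorem EE_le {p : ℤ} {f : ℕ} [NeZero f] (hp : 2 ≤ p) (y z : ZMod f → ℤ)
    (h : ∀ i, EE p y i ≤ EE p z i) : ∀ i, y i ≤ z i := by
  intro i
  have := EE_nonneg hp (fun j => z j - y j) (fun i => by rw [EE_sub]; linarith [h i]) i
  simpa using this

theorem EE_inj {p : ℤ} {f : ℕ} [NeZero f] (hp : 2 ≤ p) (y z : ZMod f → ℤ)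
    (h : ∀ i, EE p y i = EE p z i) : y = z :=
  funext fun i => le_antisymm (EE_le hp y z (fun i => (h i).le) i)
    (EE_le hp z y (fun i => (h i).ge) i)

theorem exists_top {p : ℤ} {f M : ℕ} [NeZero f] {N : ℕ → ℤ} (h : Dat p f M N)
    (a b : ZMod f → ℤ) (ha : ∀ i, 0 ≤ a i ∧ a i ≤ N i.val) (hb : ∀ i, 0 ≤ b i ∧ b i ≤ N i.val)
    (hne : a ≠ b) : ∃ e, e < M ∧ min (a e) (N e) ≠ min (b e) (N e) ∧
      ∀ e' : ℕ, e < e' → min (a e') (N e') = min (b e') (N e') := by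
  classical
  have hbig : ∀ e : ℕ, M ≤ e → min (a e) (N e) = min (b e) (N e) := by
    intro e he
    rw [h.hM e he, min_eq_right (ha _).1, min_eq_right (hb _).1]
  obtain ⟨i, hi⟩ := Function.ne_iff.mp hne
  have hex : i.val ∈ (Finset.range M).filter
      (fun e : ℕ => min (a e) (N e) ≠ min (b e) (N e)) := by
    have h1 : min (a (i.val : ℕ)) (N i.val) ≠ min (b (i.val : ℕ)) (N i.val) := by
      rw [ZMod.natCast_zmod_val, min_eq_left (ha i).2, min_eq_left (hb i).2]; exact hi
    simp only [Finset.mem_filter, Finset.mem_range]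
    refine ⟨?_, h1⟩
    by_contra hc
    exact h1 (hbig _ (by omega))
  obtain ⟨e, he, hmax⟩ := Finset.exists_max_image _ (fun e => e) ⟨_, hex⟩
  simp only [Finset.mem_filter, Finset.mem_range] at he hmax
  refine ⟨e, he.1, he.2, fun e' he' => ?_⟩
  by_contra hc
  by_cases hM : e' < M
  · have := hmax e' ⟨hM, hc⟩; omega
  · exact hc (hbig e' (by omega))

theorem T_inj {p : ℤ} {f M : ℕ} [NeZero f] {N : ℕ → ℤ} (h : Dat p f M N)
    (y z : ZMod f → ℤ) (hy : Good p N y) (hz : Good p N z)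
    (hT : TT p f M N (EE p y) = TT p f M N (EE p z)) : y = z := by
  by_contra hne
  have hne' : EE p y ≠ EE p z := fun hc => hne (EE_inj h.hp y z (fun i => congrFun hc i))
  obtain ⟨e, he, h1, h2⟩ := exists_top h _ _ hy hz hne'
  rcases lt_or_gt_of_ne h1 with h3 | h3
  · have := T_lex h _ _ e he (fun e' he' => (h2 e' he').symm) h3
    omega
  · have := T_lex h _ _ e he (fun e' he' => (h2 e' he')) h3
    omega

theorem EE_sup_inf {p : ℤ} {f : ℕ} (hp : 2 ≤ p) (a b : ZMod f → ℤ) (i : ZMod f) :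
    EE p (fun j => max (a j) (b j)) i + EE p (fun j => min (a j) (b j)) i = EE p a i + EE p b i ∧
    min (EE p a i) (EE p b i) ≤ EE p (fun j => max (a j) (b j)) i ∧
    min (EE p a i) (EE p b i) ≤ EE p (fun j => min (a j) (b j)) i ∧
    EE p (fun j => max (a j) (b j)) i ≤ max (EE p a i) (EE p b i) ∧
    EE p (fun j => min (a j) (b j)) i ≤ max (EE p a i) (EE p b i) := by
  simp only [EE]
  rcases le_total (a (i+1)) (b (i+1)) with h1 | h1 <;> rcases le_total (a i) (b i) with h2 | h2 <;>
    simp only [h1, h2, max_eq_left, max_eq_right, min_eq_left, min_eq_right] <;>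
    have h3 := mul_le_mul_of_nonneg_left h1 (show (0:ℤ) ≤ p by linarith) <;>
    refine ⟨?_, ?_, ?_, ?_, ?_⟩ <;> first | trivial | omega

theorem Good_sup {p : ℤ} {f : ℕ} {N : ℕ → ℤ} (hp : 2 ≤ p) {a b : ZMod f → ℤ} (ha : Good p N a)
    (hb : Good p N b) : Good p N (fun j => max (a j) (b j)) := by
  intro i
  obtain ⟨-, h1, h2, h3, h4⟩ := EE_sup_inf hp a b i
  have := ha i; have := hb i
  omega

theorem Good_inf {p : ℤ} {f : ℕ} {N : ℕ → ℤ} (hp : 2 ≤ p) {a b : ZMod f → ℤ} (ha : Good p N a)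
    (hb : Good p N b) : Good p N (fun j => min (a j) (b j)) := by
  intro i
  obtain ⟨-, h1, h2, h3, h4⟩ := EE_sup_inf hp a b i
  have := ha i; have := hb i
  omega

theorem T_supermod {p : ℤ} {f M : ℕ} {N : ℕ → ℤ} (h : Dat p f M N) {a b : ZMod f → ℤ}
    (ha : Good p N a) (hb : Good p N b) :
    TT p f M N (EE p a) + TT p f M N (EE p b) ≤
      TT p f M N (EE p (fun j => max (a j) (b j))) + TT p f M N (EE p (fun j => min (a j) (b j))) :=
  T_concave h _ _ _ _ (fun i => (EE_sup_inf h.hp a b i).1) (fun i => (EE_sup_inf h.hp a b i).2.1)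
    (fun i => (EE_sup_inf h.hp a b i).2.2.1) (fun i => (ha i).1) (fun i => (hb i).1)

theorem T_le {p : ℤ} {f M : ℕ} {N : ℕ → ℤ} (h : Dat p f M N) {a : ZMod f → ℤ}
    (ha : ∀ i, 0 ≤ a i) : TT p f M N a ≤ Phi p f M N :=
  Phi_mono (by linarith [h.hp]) _ _ (fun e => min_le_right _ _)
    (fun e he => by rw [h.hM e he]; exact min_eq_right (ha _))

structure IsMx (p : ℤ) (f M : ℕ) (N : ℕ → ℤ) (l h w : ZMod f → ℤ) : Prop where
  good : Good p N w
  lo : ∀ i, l i ≤ w i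
  hi : ∀ i, w i ≤ h i
  mx : ∀ y, Good p N y → (∀ i, l i ≤ y i) → (∀ i, y i ≤ h i) →
    TT p f M N (EE p y) ≤ TT p f M N (EE p w)

theorem exists_IsMx {p : ℤ} {f M : ℕ} {N : ℕ → ℤ} (h : Dat p f M N) (l hh y : ZMod f → ℤ)
    (h1 : Good p N y) (h2 : ∀ i, l i ≤ y i) (h3 : ∀ i, y i ≤ hh i) :
    ∃ w, IsMx p f M N l hh w := by
  obtain ⟨w, hw, hm⟩ := exists_max_int
    (fun y : ZMod f → ℤ => Good p N y ∧ (∀ i, l i ≤ y i) ∧ (∀ i, y i ≤ hh i))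
    (fun y => TT p f M N (EE p y)) (Phi p f M N) ⟨y, h1, h2, h3⟩
    (fun y hy => T_le h (fun i => (hy.1 i).1))
  exact ⟨w, hw.1, hw.2.1, hw.2.2, fun y a b c => hm y ⟨a, b, c⟩⟩

/-- minimal sum selection over functions on ZMod f, bounded below -/
theorem exists_min_sum {f : ℕ} [NeZero f] (P : (ZMod f → ℤ) → Prop) (b : ZMod f → ℤ)
    (hb : ∀ y, P y → ∀ i, b i ≤ y i) (hex : ∃ y, P y) :
    ∃ y, P y ∧ ∀ z, P z → ∑ i, y i ≤ ∑ i, z i := by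
  obtain ⟨y, hy, hm⟩ := exists_max_int P (fun y => - ∑ i, y i) (-∑ i, b i) hex
    (fun y hy => by have := Finset.sum_le_sum (s := Finset.univ) (fun i _ => hb y hy i); linarith)
  exact ⟨y, hy, fun z hz => by have := hm z hz; linarith⟩

theorem exists_max_sum {f : ℕ} [NeZero f] (P : (ZMod f → ℤ) → Prop) (b : ZMod f → ℤ)
    (hb : ∀ y, P y → ∀ i, y i ≤ b i) (hex : ∃ y, P y) :
    ∃ y, P y ∧ ∀ z, P z → ∑ i, z i ≤ ∑ i, y i := by
  exact exists_max_int P (fun y => ∑ i, y i) (∑ i, b i) hex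
    (fun y hy => Finset.sum_le_sum (fun i _ => hb y hy i))

theorem sum_update {f : ℕ} [NeZero f] (y : ZMod f → ℤ) (i : ZMod f) (c : ℤ) :
    ∑ j, Function.update y i c j = ∑ j, y j - y i + c := by
  rw [Finset.sum_update_of_mem (Finset.mem_univ i), ← Finset.add_sum_erase _ _ (Finset.mem_univ i),
    Finset.sdiff_singleton_eq_erase]
  ring

end MZ

namespace MZ

theorem EE_update_le {p : ℤ} {f : ℕ} (hp : 2 ≤ p) (y : ZMod f → ℤ) (i j : ZMod f) :
    EE p (Function.update y i (y i - 1)) j ≤ EE p y j + (if j = i then 1 else 0) := by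
  simp only [EE, Function.update_apply]
  split_ifs <;> first | omega | (subst_vars; simp_all) <;> linarith

theorem EE_update_ge {p : ℤ} {f : ℕ} (hp : 2 ≤ p) (y : ZMod f → ℤ) (i j : ZMod f) :
    EE p y j - (if j = i then 1 else 0) ≤ EE p (Function.update y i (y i + 1)) j := by
  have h : p * (y i + 1) = p * y i + p := by ring
  simp only [EE, Function.update_apply]
  split_ifs with h1 h2 h2
  · rw [h2, h1]; linarith
  · rw [h1]; linarith
  · rw [h2]; linarith
  · linarith

theorem lemmaD {p : ℤ} {f M : ℕ} [NeZero f] {N : ℕ → ℤ} (h : Dat p f M N)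
    {l hh w v : ZMod f → ℤ} (hw : IsMx p f M N l hh w)
    (hv : IsMx p f M N (fun i => w i + 1) (fun i => hh i + 1) v) (i : ZMod f) :
    EE p w i ≤ EE p v i := by
  by_contra hcon
  have hp := h.hp
  set δ : ZMod f → ℤ := fun j => v j - w j with hδ
  have hEδ : ∀ j, EE p δ j = EE p v j - EE p w j := fun j => EE_sub v w j
  have hδ1 : ∀ j, 1 ≤ δ j := fun j => by have := hv.lo j; simp only [hδ]; omega
  obtain ⟨D, ⟨hD0, hD1, hDi, hDE⟩, hmin⟩ := exists_min_sum
    (fun D : ZMod f → ℤ => (∀ j, 0 ≤ D j) ∧ (∀ j, D j ≤ δ j - 1) ∧ 1 ≤ D i ∧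
      ∀ j, EE p D j ≤ max (EE p δ j) 0) (fun _ => 0) (fun y hy j => hy.1 j) (by
      refine ⟨fun j => δ j - 1, fun j => by have := hδ1 j; show 0 ≤ δ j - 1; omega, fun j => le_rfl, ?_, ?_⟩
      · have h1 : EE p δ i < 0 := by rw [hEδ]; omega
        simp only [EE] at h1
        have := hδ1 (i+1)
        have : 2 ≤ δ i := by nlinarith
        linarith
      · intro j
        apply le_max_of_le_left
        simp only [EE]; linarith)
  have htight : ∀ j, D j = 0 ∨ (j = i ∧ D j = 1) ∨ max (EE p δ j) 0 ≤ EE p D j := by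
    intro j
    by_contra hc
    push Not at hc
    obtain ⟨c1, c2, c3⟩ := hc
    have c1' : 1 ≤ D j := by have := hD0 j; omega
    have := hmin (Function.update D j (D j - 1)) ⟨?_, ?_, ?_, ?_⟩
    · rw [sum_update] at this; linarith
    · intro k
      rw [Function.update_apply]; split_ifs
      · omega
      · exact hD0 k
    · intro k
      rw [Function.update_apply]; split_ifs with hk
      · subst hk; have := hD1 k; omega
      · exact hD1 k
    · rw [Function.update_apply]; split_ifs with hk
      · subst hk; have := c2 rfl; omega
      · exact hDi
    · intro k
      refine (EE_update_le hp D j k).trans ?_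
      split_ifs with hk
      · subst hk; omega
      · simpa using hDE k
  have conf : ∀ j, (0 ≤ EE p D j ∧ EE p D j ≤ EE p δ j) ∨ (EE p δ j ≤ EE p D j ∧ EE p D j ≤ 0) := by
    intro j
    have h1 := hDE j
    have hm : 0 ≤ p * D (j+1) := mul_nonneg (by linarith) (hD0 _)
    rcases htight j with h2 | ⟨rfl, h2⟩ | h2
    · have : 0 ≤ EE p D j := by simp only [EE]; linarith
      omega
    · have : -1 ≤ EE p D j := by simp only [EE]; linarith
      have := hEδ j
      omega
    · omega
  have hE1 : ∀ j, EE p (fun k => w k + D k) j = EE p w j + EE p D j := fun j => EE_add w D j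
  have hE2 : ∀ j, EE p (fun k => v k - D k) j = EE p v j - EE p D j := fun j => EE_sub v D j
  have g1 : Good p N (fun k => w k + D k) := by
    intro j
    have := hw.good j; have := hv.good j; have := hE1 j; have := hEδ j
    rcases conf j with hc | hc <;> omega
  have g2 : Good p N (fun k => v k - D k) := by
    intro j
    have := hw.good j; have := hv.good j; have := hE2 j; have := hEδ j
    rcases conf j with hc | hc <;> omega
  have m1 := hw.mx _ g1 (fun j => by have := hw.lo j; have := hD0 j; omega)
    (fun j => by have := hv.hi j; have := hD1 j; simp only [hδ] at this; omega)
  have m2 := hv.mx _ g2 (fun j => by have := hD1 j; simp only [hδ] at this; omega)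
    (fun j => by have := hv.hi j; have := hD0 j; omega)
  have cc := T_concave h (EE p w) (EE p v) (EE p (fun k => w k + D k)) (EE p (fun k => v k - D k))
    (fun j => by rw [hE1, hE2]; ring)
    (fun j => by have := hE1 j; have := hEδ j; rcases conf j with hc | hc <;> omega)
    (fun j => by have := hE2 j; have := hEδ j; rcases conf j with hc | hc <;> omega)
    (fun j => (hw.good j).1) (fun j => (hv.good j).1)
  have := T_inj h _ _ g1 hw.good (by linarith)
  have := congrFun this i
  omega

structure IsCl (p : ℤ) {f : ℕ} (N : ℕ → ℤ) (v z : ZMod f → ℤ) : Prop where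
  ge : ∀ i, v i ≤ z i
  eu : ∀ i, EE p z i ≤ N i.val
  least : ∀ z', (∀ i, v i ≤ z' i) → (∀ i, EE p z' i ≤ N i.val) → ∀ i, z i ≤ z' i

theorem exists_IsCl {p : ℤ} {f : ℕ} [NeZero f] {N : ℕ → ℤ} (hp : 2 ≤ p) (v cap : ZMod f → ℤ)
    (h1 : ∀ i, v i ≤ cap i) (h2 : ∀ i, EE p cap i ≤ N i.val) : ∃ z, IsCl p N v z := by
  obtain ⟨z, ⟨hz1, hz2⟩, hmin⟩ := exists_min_sum
    (fun z : ZMod f → ℤ => (∀ i, v i ≤ z i) ∧ ∀ i, EE p z i ≤ N i.val) v (fun y hy => hy.1)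
    ⟨cap, h1, h2⟩
  refine ⟨z, hz1, hz2, fun z' a b i => ?_⟩
  have h3 := hmin (fun j => min (z j) (z' j)) ⟨fun j => le_min (hz1 j) (a j), fun j => by
    obtain ⟨-, -, -, -, h4⟩ := EE_sup_inf hp z z' j
    exact h4.trans (max_le (hz2 j) (b j))⟩
  have h4 := (Finset.sum_eq_sum_iff_of_le (s := Finset.univ) (f := fun j => min (z j) (z' j)) (g := z)
    (fun j _ => min_le_left _ _)).mp
    (le_antisymm (Finset.sum_le_sum (fun j _ => min_le_left _ _)) h3) i (Finset.mem_univ _)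
  simpa using h4

theorem IsCl_tight {p : ℤ} {f : ℕ} [NeZero f] {N : ℕ → ℤ} (hp : 2 ≤ p) {v z : ZMod f → ℤ}
    (hz : IsCl p N v z) (i : ZMod f) : z i = v i ∨ EE p z i = N i.val := by
  by_contra hc
  push Not at hc
  have h1 := hz.ge i
  have h2 := hz.eu i
  have := hz.least (Function.update z i (z i - 1)) (fun j => by
      rw [Function.update_apply]; split_ifs with hj
      · subst hj; omega
      · exact hz.ge j) (fun j => by
      refine (EE_update_le hp z i j).trans ?_
      split_ifs with hj
      · subst hj; omega
      · simpa using hz.eu j) i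
  simp at this

structure IsHull (p : ℤ) {f : ℕ} (t y : ZMod f → ℤ) : Prop where
  ge : ∀ i, 1 ≤ y i
  le : ∀ i, y i ≤ t i
  e0 : ∀ i, 0 ≤ EE p y i
  great : ∀ z, (∀ i, z i ≤ t i) → (∀ i, 0 ≤ EE p z i) → ∀ i, z i ≤ y i

theorem exists_IsHull {p : ℤ} {f : ℕ} [NeZero f] (hp : 2 ≤ p) (t : ZMod f → ℤ)
    (h1 : ∀ i, 1 ≤ t i) : ∃ z, IsHull p t z := by
  obtain ⟨z, ⟨hz0, hz1, hz2⟩, hmax⟩ := exists_max_sum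
    (fun z : ZMod f → ℤ => (∀ i, 1 ≤ z i) ∧ (∀ i, z i ≤ t i) ∧ ∀ i, 0 ≤ EE p z i) t
    (fun y hy => hy.2.1)
    ⟨fun _ => 1, fun _ => le_rfl, h1, fun i => by simp only [EE]; linarith⟩
  refine ⟨z, hz0, hz1, hz2, fun z' a b i => ?_⟩
  have h3 := hmax (fun j => max (z j) (z' j)) ⟨fun j => le_max_of_le_left (hz0 j),
    fun j => max_le (hz1 j) (a j), fun j => by
    obtain ⟨-, h4, -⟩ := EE_sup_inf hp z z' j
    exact (le_min (hz2 j) (b j)).trans h4⟩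
  have h4 := (Finset.sum_eq_sum_iff_of_le (s := Finset.univ) (f := z) (g := fun j => max (z j) (z' j))
    (fun j _ => le_max_left _ _)).mp
    (le_antisymm (Finset.sum_le_sum (fun j _ => le_max_left _ _)) h3) i (Finset.mem_univ _)
  rw [h4]; exact le_max_right _ _

theorem IsHull_tight {p : ℤ} {f : ℕ} [NeZero f] (hp : 2 ≤ p) {t z : ZMod f → ℤ}
    (hz : IsHull p t z) (i : ZMod f) : z i = t i ∨ EE p z i = 0 := by
  by_contra hc
  push Not at hc
  have h1 := hz.le i
  have h2 := hz.e0 i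
  have := hz.great (Function.update z i (z i + 1)) (fun j => by
      rw [Function.update_apply]; split_ifs with hj
      · subst hj; omega
      · exact hz.le j) (fun j => by
      refine le_trans ?_ (EE_update_ge hp z i j)
      split_ifs with hj
      · subst hj; omega
      · simpa using hz.e0 j) i
  simp at this

structure IsCh (p : ℤ) {f : ℕ} (N : ℕ → ℤ) (X : ZMod f → ℤ) (d : ℕ) (l : ZMod f → ℤ)
    (y : ℕ → ZMod f → ℤ) : Prop where
  good : ∀ j, j < d → Good p N (y j)
  lo : 0 < d → ∀ i, l i ≤ y 0 i
  step : ∀ j, j + 1 < d → ∀ i, y j i + 1 ≤ y (j + 1) i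
  hi : ∀ j, j < d → ∀ i, y j i + ((d : ℤ) - 1 - j) ≤ X i

/-- nonemptiness -/
theorem exists_IsCh {p : ℤ} {f : ℕ} [NeZero f] {N : ℕ → ℤ} (hp : 2 ≤ p) (hN : ∀ e, 0 ≤ N e)
    (X : ZMod f → ℤ)
    (hX : ∀ i, EE p X i ≤ N i.val) (d : ℕ) (hd : ∀ i, d ≤ X i) :
    ∃ y, IsCh p N X d (fun _ => 1) y := by
  have : ∀ j : ℕ, ∃ y : ZMod f → ℤ, j < d → IsHull p (fun i => X i - ((d : ℤ) - 1 - j)) y := by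
    intro j
    by_cases hj : j < d
    · obtain ⟨y, hy⟩ := exists_IsHull hp (fun i => X i - ((d : ℤ) - 1 - j))
        (fun i => by have := hd i; omega)
      exact ⟨y, fun _ => hy⟩
    · exact ⟨0, fun h => absurd h hj⟩
  choose y hy using this
  refine ⟨y, ?_, ?_, ?_, ?_⟩
  · intro j hj i
    refine ⟨(hy j hj).e0 i, ?_⟩
    rcases IsHull_tight hp (hy j hj) i with h1 | h1
    · have h2 := hX i
      have h3 := (hy j hj).le (i+1)
      have h4 : p * y j (i+1) ≤ p * (X (i+1) - ((d : ℤ) - 1 - j)) :=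
        mul_le_mul_of_nonneg_left h3 (by linarith)
      have h5 : (0:ℤ) ≤ (d : ℤ) - 1 - j := by omega
      simp only [EE] at *
      rw [h1]
      nlinarith
    · rw [h1]; exact hN _
  · intro hd i
    exact (hy 0 hd).ge i
  · intro j hj i
    have h1 := hy j (by omega)
    have h2 := hy (j+1) hj
    refine h2.great (fun i => y j i + 1) (fun i => ?_) (fun i => ?_) i
    · have := h1.le i; push_cast; linarith
    · have := h1.e0 i
      simp only [EE] at *
      linarith
  · intro j hj i
    have := (hy j hj).le i
    linarith

end MZ

namespace MZ

theorem N_anti {p : ℤ} {f M : ℕ} {N : ℕ → ℤ} (h : Dat p f M N) (e e' : ℕ) (hle : e ≤ e')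
    (hc : (e : ZMod f) = (e' : ZMod f)) : N e' ≤ N e := by
  rw [ZMod.natCast_eq_natCast_iff] at hc
  obtain ⟨c, hc'⟩ := (Nat.modEq_iff_dvd' hle).mp hc
  have : e' = e + f * c := by omega
  subst this
  clear hle hc hc'
  induction c with
  | zero => simp
  | succ c ih => exact le_trans (by rw [Nat.mul_succ, ← add_assoc]; exact h.lo _) ih

theorem N_le_val {p : ℤ} {f M : ℕ} [NeZero f] {N : ℕ → ℤ} (h : Dat p f M N) (e : ℕ) :
    N e ≤ N (e : ZMod f).val :=
  N_anti h _ _ (by rw [ZMod.val_natCast]; exact Nat.mod_le _ _) (by simp)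

/-- weak lexicographic comparison -/
theorem T_lex' {p : ℤ} {f M : ℕ} [NeZero f] {N : ℕ → ℤ} (h : Dat p f M N)
    (a b : ZMod f → ℤ) (ha : ∀ i, 0 ≤ a i ∧ a i ≤ N i.val) (hb : ∀ i, 0 ≤ b i ∧ b i ≤ N i.val)
    (e e' : ℕ) (hee : e < e') (hge : ∀ k : ℕ, e < k → min (b k) (N k) ≤ min (a k) (N k))
    (hlt : min (b e') (N e') < min (a e') (N e')) : TT p f M N b < TT p f M N a := by
  have hne : a ≠ b := by rintro rfl; exact lt_irrefl _ hlt
  obtain ⟨e1, he1, h1, h2⟩ := exists_top h a b ha hb hne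
  have h3 : e < e1 := by
    by_contra hc
    have := h2 e' (by omega)
    omega
  exact T_lex h a b e1 he1 h2 (lt_of_le_of_ne (hge e1 h3) (Ne.symm h1))

theorem lemmaH {p : ℤ} {f M : ℕ} [NeZero f] {N : ℕ → ℤ} (h : Dat p f M N)
    {l hh w y : ZMod f → ℤ} (hw : IsMx p f M N l hh w) (hy : Good p N y) (hly : ∀ i, l i ≤ y i)
    (hyw : ∀ i, y i ≤ w i) (e : ℕ)
    (heq : ∀ e' : ℕ, e < e' → min (EE p w e') (N e') = min (EE p y e') (N e'))
    (i : ZMod f) (hi : y i < w i) (e' : ℕ) (he' : e < e') (hc : (e' : ZMod f) = i) :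
    N e' ≤ EE p w i := by
  by_contra hcon
  push Not at hcon
  have hp := h.hp
  have h0 := heq e' he'
  rw [hc] at h0
  have hEq : EE p y i = EE p w i := by omega
  set D : ZMod f → ℤ := fun j => w j - y j with hD
  have hED : ∀ j, EE p D j = EE p w j - EE p y j := fun j => EE_sub w y j
  have hD0 : ∀ j, 0 ≤ D j := fun j => by have := hyw j; show 0 ≤ w j - y j; omega
  have hDi : 1 ≤ D i := by show 1 ≤ w i - y i; omega
  have hEDi : p * D (i+1) - D i = 0 := by have := hED i; simp only [EE] at *; linarith
  have hDi1 : 1 ≤ D (i+1) := by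
    by_contra hcc
    have : D (i+1) = 0 := by have := hD0 (i+1); omega
    rw [this] at hEDi; linarith
  have hDi2 : 2 ≤ D i := by nlinarith
  obtain ⟨D', ⟨h1, h2, h3, h4, h5⟩, hmax⟩ := exists_max_sum
    (fun D' : ZMod f → ℤ => (∀ j, min (D j) 1 ≤ D' j) ∧ (∀ j, D' j ≤ D j) ∧ D' i ≤ D i - 1 ∧
      1 ≤ EE p D' i ∧ ∀ j, j ≠ i → min 0 (EE p D j) ≤ EE p D' j) D (fun y hy j => hy.2.1 j) (by
      refine ⟨fun j => min (D j) 1, fun j => le_rfl, fun j => min_le_left _ _, ?_, ?_, ?_⟩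
      · show min (D i) 1 ≤ D i - 1
        omega
      · simp only [EE]
        rw [min_eq_right hDi1, min_eq_right hDi]; linarith
      · intro j hj
        simp only [EE]
        rcases le_or_gt 1 (D (j+1)) with c | c
        · rw [min_eq_right c]
          have := min_le_right (D j) 1
          have := min_le_left 0 (p * D (j+1) - D j)
          linarith
        · have c' : D (j+1) = 0 := by have := hD0 (j+1); omega
          rw [c']
          have := hD0 j
          simp only [show min (0:ℤ) 1 = 0 from rfl, mul_zero]
          omega)
  have tight : ∀ j, D' j = D j ∨ (j = i ∧ D' i = D i - 1) ∨ (j ≠ i ∧ EE p D' j = min 0 (EE p D j)) ∨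
      (j = i ∧ EE p D' i = 1) := by
    intro j
    by_contra hcc
    push Not at hcc
    obtain ⟨c1, c2, c3, c4⟩ := hcc
    have := hmax (Function.update D' j (D' j + 1)) ⟨?_, ?_, ?_, ?_, ?_⟩
    · rw [sum_update] at this; linarith
    · intro k
      rw [Function.update_apply]; split_ifs with hk
      · subst hk; have := h1 k; omega
      · exact h1 k
    · intro k
      rw [Function.update_apply]; split_ifs with hk
      · subst hk; have := h2 k; omega
      · exact h2 k
    · rw [Function.update_apply]; split_ifs with hk
      · subst hk; have := c2 rfl; omega
      · exact h3
    · refine le_trans ?_ (EE_update_ge hp D' j i)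
      split_ifs with hk
      · subst hk; have := c4 rfl; omega
      · linarith
    · intro k hk
      refine le_trans ?_ (EE_update_ge hp D' j k)
      split_ifs with hk'
      · subst hk'; have := c3 hk; have := h5 k hk; omega
      · linarith [h5 k hk]
  have hE1 : ∀ j, EE p (fun k => y k + D' k) j = EE p y j + EE p D' j := fun j => EE_add y D' j
  have hle1 : ∀ j, p * D' (j+1) ≤ p * D (j+1) :=
    fun j => mul_le_mul_of_nonneg_left (h2 _) (by linarith)
  have hui : EE p w i + 1 ≤ N i.val := by
    have := N_le_val (f := f) h e'
    rw [hc] at this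
    omega
  have g : Good p N (fun k => y k + D' k) := by
    intro j
    have a1 := hy j; have a2 := hw.good j; have a3 := hE1 j; have a4 := hED j
    have a5 := hle1 j
    by_cases hj : j = i
    · subst hj
      have : EE p D' j ≤ 1 := by
        rcases tight j with c | ⟨-, c⟩ | ⟨c, -⟩ | ⟨-, c⟩
        · omega
        · simp only [EE]; omega
        · exact absurd rfl c
        · omega
      omega
    · have a6 := h5 j hj
      refine ⟨by omega, ?_⟩
      rcases tight j with c | ⟨c, -⟩ | ⟨-, c⟩ | ⟨c, -⟩
      · have : EE p D' j ≤ EE p D j := by simp only [EE]; omega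
        omega
      · exact absurd c hj
      · omega
      · exact absurd c hj
  have hge : ∀ j, min (EE p y j) (EE p w j) ≤ EE p (fun k => y k + D' k) j := by
    intro j
    have a3 := hE1 j; have a4 := hED j
    by_cases hj : j = i
    · subst hj; omega
    · have a6 := h5 j hj
      omega
  have hm := hw.mx _ g (fun j => by
      have := hly j; have := h1 j; have := hD0 j; show l j ≤ y j + D' j; omega)
    (fun j => by
      have := hw.hi j; have := h2 j; simp only [hD] at this; show y j + D' j ≤ hh j; omega)
  have := T_lex' h _ _ g hw.good e e' he' (fun k hk => by
      have b1 := heq k hk; have b2 := hge k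
      omega) (by
      rw [hc]
      have a3 := hE1 i
      omega)
  omega

theorem digit_bound (p : ℤ) (hp : 2 ≤ p) (f : ℕ) (hf : 0 < f) (e : ℕ) :
    ∑ k ∈ Finset.range e, p ^ k * (if (k : ZMod f) = (e : ZMod f) then p - 1 else p ^ f * (p - 1))
      ≤ p ^ e * (p ^ f - p + 1) - 1 := by
  induction e using Nat.strong_induction_on with
  | _ e ih =>
    rcases lt_or_ge e f with hlt | hge
    · have h1 : ∑ k ∈ Finset.range e, p ^ k * (if (k : ZMod f) = (e : ZMod f) then p - 1
          else p ^ f * (p - 1)) = p ^ f * ∑ k ∈ Finset.range e, p ^ k * (p - 1) := by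
        rw [Finset.mul_sum]
        apply Finset.sum_congr rfl
        intro k hk
        rw [Finset.mem_range] at hk
        rw [if_neg]
        · ring
        · rw [ZMod.natCast_eq_natCast_iff, Nat.ModEq, Nat.mod_eq_of_lt hlt,
            Nat.mod_eq_of_lt (by omega)]
          omega
      rw [h1, geom_low]
      have h2 : p ^ (e + 1) ≤ p ^ f := pow_le_pow_right₀ (by linarith) (by omega)
      have h3 : 1 ≤ p ^ e := one_le_pow₀ (by linarith)
      rw [pow_succ] at h2
      nlinarith
    · obtain ⟨c, rfl⟩ : ∃ c, e = c + f := ⟨e - f, by omega⟩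
      have h1 := ih c (by omega)
      rw [Finset.sum_range_add]
      have hcast : ((c + f : ℕ) : ZMod f) = (c : ZMod f) := by simp
      simp only [hcast]
      have h2 : ∑ x ∈ Finset.range f, p ^ (c + x) * (if ((c + x : ℕ) : ZMod f) = (c : ZMod f)
          then p - 1 else p ^ f * (p - 1)) = p ^ c * ((p - 1) + p ^ f * (p ^ f - p)) := by
        obtain ⟨g, rfl⟩ : ∃ g, f = g + 1 := ⟨f - 1, by omega⟩
        rw [Finset.sum_range_succ']
        have h3 : ∀ x ∈ Finset.range g, p ^ (c + (x + 1)) *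
            (if ((c + (x + 1) : ℕ) : ZMod (g+1)) = (c : ZMod (g+1))
            then p - 1 else p ^ (g+1) * (p - 1)) = p ^ c * p ^ (g + 1) * p * (p ^ x * (p - 1)) := by
          intro x hx
          rw [Finset.mem_range] at hx
          rw [if_neg]
          · ring
          · rw [Nat.cast_add, add_eq_left, ZMod.natCast_eq_zero_iff]
            intro hd
            have := Nat.le_of_dvd (by omega) hd
            omega
        rw [Finset.sum_congr rfl h3, ← Finset.mul_sum, geom_low]
        simp
        ring
      rw [h2, pow_add]
      nlinarith

end MZ

namespace MZ

/-- loss function -/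
def hloss (p : ℤ) {f : ℕ} (N : ℕ → ℤ) (y w : ZMod f → ℤ) (j : ℕ) (e : ℕ) : ℤ :=
  if y e < w e then max 0 (N e - EE p w e - j * (p - 1)) else 0

theorem gap {p : ℤ} {f M : ℕ} [NeZero f] {N : ℕ → ℤ} (h : Dat p f M N)
    {l hh w y : ZMod f → ℤ} (hw : IsMx p f M N l hh w) (hy : Good p N y) (hly : ∀ i, l i ≤ y i)
    (hyw : ∀ i, y i ≤ w i) (hne : y ≠ w) :
    Phi p f M (hloss p N y w 0) < (p ^ f - 1) * (TT p f M N (EE p w) - TT p f M N (EE p y)) := by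
  have hp := h.hp
  have hq : p ≤ p ^ f := by
    calc p = p ^ 1 := (pow_one p).symm
      _ ≤ p ^ f := pow_le_pow_right₀ (by linarith) h.hf
  have hne' : EE p w ≠ EE p y := fun hc => hne (EE_inj h.hp y w (fun i => (congrFun hc i).symm))
  obtain ⟨e, he, h1, h2⟩ := exists_top h _ _ hw.good hy hne'
  have h3 : min (EE p y e) (N e) < min (EE p w e) (N e) := by
    rcases lt_or_gt_of_ne h1 with h3 | h3
    · exfalso
      have a1 := T_lex h _ _ e he (fun e' he' => (h2 e' he').symm) h3
      have a2 := hw.mx y hy hly (fun i => (hyw i).trans (hw.hi i))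
      omega
    · exact h3
  have hH := lemmaH h hw hy hly hyw e h2
  have hcf : ∀ k : ℕ, ((k + f : ℕ) : ZMod f) = (k : ZMod f) := fun k => by simp
  have h4 := h2 (e + f) (by have := h.hf; omega)
  rw [hcf] at h4
  have h4' : N (e + f) ≤ EE p y e := by omega
  rw [← sub_pos]
  unfold TT
  rw [← Phi_sub, ← Phi_smul, ← Phi_sub]
  rw [Phi_split h.hf _ e he]
  · set K : ℕ → ℤ := fun k => (p ^ f - 1) * (min (EE p w k) (N k) - min (EE p y k) (N k)) -
      hloss p N y w 0 k with hK
    have hKe : p ^ f - p + 1 ≤ K e := by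
      have b1 : hloss p N y w 0 e ≤ p - 2 := by
        unfold hloss
        have := h.hi e
        split_ifs
        · push_cast; rw [zero_mul]; omega
        · omega
      have b2 : (p ^ f - 1) * 1 ≤ (p ^ f - 1) * (min (EE p w e) (N e) - min (EE p y e) (N e)) :=
        mul_le_mul_of_nonneg_left (by omega) (by linarith)
      simp only [hK]
      linarith
    have hdig : ∀ k ∈ Finset.range e, - (p ^ k * (if (k : ZMod f) = (e : ZMod f) then p - 1
        else p ^ f * (p - 1))) ≤ p ^ k * (K k - K (k + f)) := by
      intro k hk
      rw [Finset.mem_range] at hk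
      rw [← mul_neg]
      apply mul_le_mul_of_nonneg_left _ (by positivity)
      have c1 := h.lo k
      have c2 := h.hi k
      have c3 : hloss p N y w 0 k - hloss p N y w 0 (k + f) ≤ p - 1 := by
        unfold hloss
        rw [hcf]
        split_ifs
        · push_cast; rw [zero_mul]; omega
        · omega
      simp only [hK, hcf]
      set A := min (EE p w k) (N k) - min (EE p w k) (N (k + f)) with hA
      set B := min (EE p y k) (N k) - min (EE p y k) (N (k + f)) with hB
      have hA0 : 0 ≤ A := by omega
      have hB0 : B ≤ p - 1 := by omega
      have key : (p ^ f - 1) * (min (EE p w k) (N k) - min (EE p y k) (N k)) -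
        hloss p N y w 0 k - ((p ^ f - 1) * (min (EE p w k) (N (k+f)) - min (EE p y k) (N (k+f))) -
        hloss p N y w 0 (k + f)) = (p ^ f - 1) * A - (p ^ f - 1) * B
          - (hloss p N y w 0 k - hloss p N y w 0 (k + f)) := by
        rw [hA, hB]; ring
      rw [key]
      have d1 : 0 ≤ (p ^ f - 1) * A := mul_nonneg (by linarith) hA0
      split_ifs with hke
      · have : k + f ≤ e := by
          rw [ZMod.natCast_eq_natCast_iff] at hke
          obtain ⟨c, hc⟩ := (Nat.modEq_iff_dvd' hk.le).mp hke
          have : c ≠ 0 := by rintro rfl; simp at hc; omega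
          have : f * 1 ≤ f * c := Nat.mul_le_mul_left _ (by omega)
          omega
        have h5 := N_anti (f := f) h (k + f) e this (by rw [hcf]; exact hke)
        rw [← hke] at h3
        have : B = 0 := by omega
        rw [this]; linarith
      · have d2 : (p ^ f - 1) * B ≤ (p ^ f - 1) * (p - 1) :=
          mul_le_mul_of_nonneg_left hB0 (by linarith)
        linarith
    have hs := Finset.sum_le_sum hdig
    rw [Finset.sum_neg_distrib] at hs
    have hb := digit_bound p hp f h.hf e
    have hm : p ^ e * (p ^ f - p + 1) ≤ p ^ e * K e :=
      mul_le_mul_of_nonneg_left hKe (by positivity)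
    linarith
  · intro k hk
    have := h2 k hk
    rw [this]
    unfold hloss
    split_ifs with hlt
    · have := hH k hlt k hk rfl
      have : max 0 (N k - EE p w k - ((0:ℕ):ℤ) * (p - 1)) = 0 := by
        push_cast; rw [zero_mul]; omega
      rw [this]; ring
    · ring

theorem hloss_shift {p : ℤ} {f M : ℕ} {N : ℕ → ℤ} (h : Dat p f M N) {y w : ZMod f → ℤ}
    (hw : ∀ i, 0 ≤ EE p w i) (j : ℕ) :
    p ^ f * Phi p f M (hloss p N y w (j + 1)) ≤ Phi p f M (hloss p N y w j) := by
  have hp := h.hp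
  have hz : ∀ j e, M ≤ e → hloss p N y w j e = 0 := by
    intro j e he
    unfold hloss
    have h1 : 0 ≤ (j : ℤ) * (p - 1) := mul_nonneg (by positivity) (by linarith)
    have := hw e
    split_ifs
    · rw [h.hM e he]; omega
    · rfl
  have hcf : ∀ k : ℕ, ((k + f : ℕ) : ZMod f) = (k : ZMod f) := fun k => by simp
  have h1 : Phi p f M (hloss p N y w (j + 1)) ≤ Phi p f M (fun e => hloss p N y w j (e + f)) := by
    apply Phi_mono (by linarith)
    · intro e
      unfold hloss
      rw [hcf]
      have := h.hi e
      have : ((j + 1 : ℕ) : ℤ) * (p - 1) = j * (p - 1) + (p - 1) := by push_cast; ring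
      split_ifs
      · omega
      · omega
    · intro e he
      rw [hz _ e he, hz _ (e + f) (by omega)]
  refine le_trans (mul_le_mul_of_nonneg_left h1 (by positivity)) ?_
  apply Phi_shift (by linarith)
  · intro e
    unfold hloss
    rw [hcf]
    have := h.lo e
    split_ifs
    · omega
    · omega
  · exact fun e he => hz j e he

theorem hloss_sum {p : ℤ} {f M : ℕ} {N : ℕ → ℤ} (h : Dat p f M N) {y w : ZMod f → ℤ}
    (hw : ∀ i, 0 ≤ EE p w i) (d : ℕ) :
    (p ^ f - 1) * ∑ j ∈ Finset.range d, Phi p f M (hloss p N y w (j + 1)) ≤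
      Phi p f M (hloss p N y w 0) - Phi p f M (hloss p N y w d) := by
  induction d with
  | zero => simp
  | succ d ih =>
    rw [Finset.sum_range_succ, mul_add]
    have := hloss_shift (y := y) h hw d
    linarith

structure Opt (p : ℤ) (f M : ℕ) (N : ℕ → ℤ) (X : ZMod f → ℤ) (d : ℕ) (l : ZMod f → ℤ)
    (y : ℕ → ZMod f → ℤ) : Prop where
  ch : IsCh p N X d l y
  opt : ∀ z, IsCh p N X d l z → ∑ j ∈ Finset.range d, TT p f M N (EE p (z j)) ≤
    ∑ j ∈ Finset.range d, TT p f M N (EE p (y j))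

theorem R1 {p : ℤ} {f M : ℕ} [NeZero f] {N : ℕ → ℤ} (h : Dat p f M N) {X l : ZMod f → ℤ}
    (hX : ∀ i, EE p X i ≤ N i.val) (d : ℕ) {y : ℕ → ZMod f → ℤ} (hy : Opt p f M N X (d + 1) l y) :
    IsMx p f M N l (fun i => X i - d) (y 0) := by
  have hp := h.hp
  have hch := hy.ch
  have hy0 : Good p N (y 0) := hch.good 0 (by omega)
  have hl : ∀ i, l i ≤ y 0 i := hch.lo (by omega)
  have hyX : ∀ i, y 0 i ≤ X i - d := fun i => by have := hch.hi 0 (by omega) i; push_cast at this; linarith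
  obtain ⟨w, hw⟩ := exists_IsMx h l (fun i => X i - d) (y 0) hy0 hl hyX
  suffices hs : y 0 = w by rw [hs]; exact hw
  have hyw : ∀ i, y 0 i ≤ w i := by
    have a1 := hw.mx _ (Good_sup hp hy0 hw.good) (fun i => le_max_of_le_left (hl i))
      (fun i => max_le (hyX i) (hw.hi i))
    set z : ℕ → ZMod f → ℤ := Function.update y 0 (fun i => min (y 0 i) (w i)) with hz
    have hz0 : z 0 = fun i => min (y 0 i) (w i) := by simp [hz]
    have hzs : ∀ j, z (j + 1) = y (j + 1) := fun j => by simp [hz]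
    have a2 := hy.opt z ⟨?_, ?_, ?_, ?_⟩
    · rw [Finset.sum_range_succ', Finset.sum_range_succ'] at a2
      simp only [hzs, hz0] at a2
      have a3 := T_supermod h hy0 hw.good
      have a4 := T_inj h _ _ (Good_sup hp hy0 hw.good) hw.good (by linarith)
      intro i
      have := congrFun a4 i
      simpa using this
    · intro j hj
      cases j with
      | zero => rw [hz0]; exact Good_inf hp hy0 hw.good
      | succ j => rw [hzs]; exact hch.good _ hj
    · intro _ i
      rw [hz0]
      exact le_min (hl i) (hw.lo i)
    · intro j hj i
      cases j with
      | zero =>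
        rw [hz0, hzs]
        have := hch.step 0 hj i
        have := min_le_left (y 0 i) (w i)
        simp only []
        linarith
      | succ j => rw [hzs, hzs]; exact hch.step _ hj i
    · intro j hj i
      cases j with
      | zero =>
        rw [hz0]
        have := hch.hi 0 hj i
        have := min_le_left (y 0 i) (w i)
        simp only []
        linarith
      | succ j => rw [hzs]; exact hch.hi _ hj i
  by_contra hne
  have hgap := gap h hw hy0 hl hyw hne
  set v : ℕ → ZMod f → ℤ := fun j i => max (y j i) (w i + j) with hv
  have hcl : ∀ j : ℕ, ∃ z : ZMod f → ℤ, j < d + 1 → IsCl p N (v j) z := by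
    intro j
    by_cases hj : j < d + 1
    · obtain ⟨z, hz⟩ := exists_IsCl (N := N) hp (v j) (fun i => X i - (d - j)) (fun i => by
        have := hch.hi j hj i
        have := hw.hi i
        push_cast at *
        exact max_le (by linarith) (by linarith)) (fun i => by
        have := hX i
        have h1 : (0:ℤ) ≤ d - j := by omega
        simp only [EE] at *
        nlinarith)
      exact ⟨z, fun _ => hz⟩
    · exact ⟨0, fun hh => absurd hh hj⟩
  choose z hz using hcl
  have hE1 : ∀ (j : ℕ) i, EE p (fun k => w k + j) i = EE p w i + j * (p - 1) := by
    intro j i; simp only [EE]; ring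
  have hjp : ∀ j : ℕ, 0 ≤ (j : ℤ) * (p - 1) := fun j => mul_nonneg (by positivity) (by linarith)
  have hEv : ∀ j, j < d + 1 → ∀ i, 0 ≤ EE p (v j) i := by
    intro j hj i
    obtain ⟨-, h1, -⟩ := EE_sup_inf hp (y j) (fun k => w k + j) i
    have h2 := hch.good j hj i
    have h3 := hw.good i
    have h4 := hE1 j i
    have h5 := hjp j
    show 0 ≤ EE p (fun k => max (y j k) (w k + j)) i
    omega
  have hz0 : z 0 = w := by
    have h0 := hz 0 (by omega)
    funext i
    apply le_antisymm
    · exact h0.least w (fun i => by simp only [hv]; have := hyw i; simp [this]) (fun i => (hw.good i).2) i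
    · have := h0.ge i
      simp only [hv] at this
      exact le_trans (by simp) this
  have hEz : ∀ j, j < d + 1 → ∀ i, EE p (z j) i = N i.val ∨
      (z j i = v j i ∧ EE p (v j) i ≤ EE p (z j) i) := by
    intro j hj i
    rcases IsCl_tight hp (hz j hj) i with h1 | h1
    · right
      refine ⟨h1, ?_⟩
      have : p * v j (i+1) ≤ p * z j (i+1) := mul_le_mul_of_nonneg_left ((hz j hj).ge _) (by linarith)
      simp only [EE]; linarith
    · left; exact h1
  have hzch : IsCh p N X (d + 1) l z := by
    refine ⟨?_, ?_, ?_, ?_⟩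
    · intro j hj i
      refine ⟨?_, (hz j hj).eu i⟩
      rcases hEz j hj i with h1 | ⟨-, h1⟩
      · rw [h1]; exact N_nonneg h _
      · exact (hEv j hj i).trans h1
    · intro _ i; rw [hz0]; exact hw.lo i
    · intro j hj i
      have h1 := hz j (by omega)
      have h2 := hz (j + 1) hj
      have := h1.least (fun i => z (j+1) i - 1) (fun i => by
        have a1 := h2.ge i
        have a2 := hch.step j hj i
        simp only [hv] at *
        push_cast at a1
        omega) (fun i => by
        have := h2.eu i
        simp only [EE] at *
        linarith) i
      linarith
    · intro j hj i
      have := (hz j hj).least (fun i => X i - (d - j)) (fun i => by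
        have := hch.hi j hj i
        have := hw.hi i
        push_cast at *
        exact max_le (by linarith) (by linarith)) (fun i => by
        have := hX i
        have h1 : (0:ℤ) ≤ d - j := by omega
        simp only [EE] at *
        nlinarith) i
      push_cast
      linarith
  have hyj : ∀ j, j < d + 1 → ∀ i, y 0 i + j ≤ y j i := by
    intro j
    induction j with
    | zero => intro _ i; simp
    | succ j ih =>
      intro hj i
      have := ih (by omega) i
      have := hch.step j hj i
      push_cast; linarith
  have hloss : ∀ j, j < d + 1 → TT p f M N (EE p (y j)) - Phi p f M (hloss p N (y 0) w j) ≤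
      TT p f M N (EE p (z j)) := by
    intro j hj
    unfold TT
    rw [← Phi_sub]
    apply Phi_mono (by linarith)
    · intro e
      have b1 : 0 ≤ MZ.hloss p N (y 0) w j e := by unfold MZ.hloss; split_ifs <;> omega
      rcases hEz j hj e with h1 | ⟨h1, h2⟩
      · have := N_le_val (f := f) h e
        rw [h1]
        omega
      · rcases le_or_gt (w (e : ZMod f) + j) (y j e) with h3 | h3
        · have h4 : v j e = y j e := max_eq_left h3
          have h5 : p * y j (e + 1) ≤ p * v j (e + 1) :=
            mul_le_mul_of_nonneg_left (le_max_left _ _) (by linarith)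
          have h6 : EE p (y j) e ≤ EE p (v j) e := by simp only [EE]; linarith
          omega
        · have h4 : v j e = w e + j := max_eq_right h3.le
          have h5 : p * (w (e + 1) + j) ≤ p * v j (e + 1) :=
            mul_le_mul_of_nonneg_left (le_max_right _ _) (by linarith)
          have h6 : EE p w e + j * (p - 1) ≤ EE p (v j) e := by simp only [EE]; linarith
          have h7 : y 0 e < w e := by have := hyj j hj e; linarith
          have h8 : MZ.hloss p N (y 0) w j e = max 0 (N e - EE p w e - j * (p - 1)) := by
            unfold MZ.hloss; rw [if_pos h7]
          omega
    · intro e he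
      have h1 := h.hM e he
      have h2 := (hch.good j hj e).1
      have h3 := (hzch.good j hj e).1
      have h4 := (hw.good e).1
      have h5 := hjp j
      have h8 : MZ.hloss p N (y 0) w j e = 0 := by
        unfold MZ.hloss; split_ifs <;> omega
      omega
  have ho := hy.opt z hzch
  rw [Finset.sum_range_succ', Finset.sum_range_succ', hz0] at ho
  have hs := hloss_sum (y := y 0) h (fun i => (hw.good i).1) d
  have hn : 0 ≤ Phi p f M (MZ.hloss p N (y 0) w d) := by
    apply Phi_nonneg (by linarith)
    · intro e; unfold MZ.hloss; split_ifs <;> omega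
    · intro e he
      have h1 := h.hM e he
      have h4 := (hw.good e).1
      have h5 := hjp d
      unfold MZ.hloss; split_ifs <;> omega
  have hsum : ∑ j ∈ Finset.range d, (TT p f M N (EE p (y (j+1))) -
      Phi p f M (MZ.hloss p N (y 0) w (j+1))) ≤
      ∑ j ∈ Finset.range d, TT p f M N (EE p (z (j+1))) :=
    Finset.sum_le_sum (fun j hj => hloss (j+1) (by rw [Finset.mem_range] at hj; omega))
  rw [Finset.sum_sub_distrib] at hsum
  have hq : 1 ≤ p ^ f := one_le_pow₀ (by linarith)
  have hfin : (p ^ f - 1) * (TT p f M N (EE p w) - TT p f M N (EE p (y 0))) ≤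
     (p ^ f - 1) * ∑ j ∈ Finset.range d, Phi p f M (MZ.hloss p N (y 0) w (j + 1)) :=
    mul_le_mul_of_nonneg_left (by linarith) (by linarith)
  linarith

end MZ

namespace MZ

theorem IsMx_unique {p : ℤ} {f M : ℕ} [NeZero f] {N : ℕ → ℤ} (h : Dat p f M N)
    {l hh w v : ZMod f → ℤ} (hw : IsMx p f M N l hh w) (hv : IsMx p f M N l hh v) : w = v :=
  T_inj h _ _ hw.good hv.good
    (le_antisymm (hv.mx w hw.good hw.lo hw.hi) (hw.mx v hv.good hv.lo hv.hi))

theorem R3 {p : ℤ} {f M : ℕ} [NeZero f] {N : ℕ → ℤ} (h : Dat p f M N) {X l : ZMod f → ℤ}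
    (hX : ∀ i, EE p X i ≤ N i.val) (d : ℕ) {y z : ℕ → ZMod f → ℤ} (hy : Opt p f M N X (d + 1) l y)
    (hz : Opt p f M N X (d + 1) l z) : y 0 = z 0 :=
  IsMx_unique h (R1 h hX d hy) (R1 h hX d hz)

theorem Opt_tail {p : ℤ} {f M : ℕ} {N : ℕ → ℤ} {X l : ZMod f → ℤ}
    (d : ℕ) {y : ℕ → ZMod f → ℤ} (hy : Opt p f M N X (d + 1) l y) :
    Opt p f M N X d (fun i => y 0 i + 1) (fun j => y (j + 1)) := by
  refine ⟨⟨?_, ?_, ?_, ?_⟩, ?_⟩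
  · exact fun j hj => hy.ch.good _ (by omega)
  · exact fun hd i => hy.ch.step 0 (by omega) i
  · exact fun j hj i => hy.ch.step (j+1) (by omega) i
  · intro j hj i
    have := hy.ch.hi (j+1) (by omega) i
    push_cast at this
    linarith
  · intro z hz
    set z' : ℕ → ZMod f → ℤ := fun j => Nat.casesOn j (y 0) z with hz'
    have h0 : z' 0 = y 0 := rfl
    have hs : ∀ j, z' (j+1) = z j := fun j => rfl
    have := hy.opt z' ⟨?_, ?_, ?_, ?_⟩
    · rw [Finset.sum_range_succ', Finset.sum_range_succ'] at this
      simp only [h0, hs] at this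
      linarith
    · intro j hj
      cases j with
      | zero => exact hy.ch.good 0 hj
      | succ j => exact hz.good j (by omega)
    · exact fun hd i => hy.ch.lo hd i
    · intro j hj i
      cases j with
      | zero => exact hz.lo (by omega) i
      | succ j => exact hz.step j (by omega) i
    · intro j hj i
      cases j with
      | zero => exact hy.ch.hi 0 hj i
      | succ j =>
        have := hz.hi j (by omega) i
        rw [hs]; push_cast; linarith

theorem R2 {p : ℤ} {f M : ℕ} [NeZero f] {N : ℕ → ℤ} (h : Dat p f M N) {X : ZMod f → ℤ}
    (hX : ∀ i, EE p X i ≤ N i.val) (d : ℕ) : ∀ (l : ZMod f → ℤ) (y : ℕ → ZMod f → ℤ),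
    Opt p f M N X d l y → ∀ j, j + 1 < d → ∀ i, EE p (y j) i ≤ EE p (y (j + 1)) i := by
  induction d with
  | zero => intro l y _ j hj; omega
  | succ d ih =>
    intro l y hy j hj i
    have ht := Opt_tail d hy
    cases j with
    | succ j => exact ih _ _ ht j (by omega) i
    | zero =>
      obtain ⟨c, rfl⟩ : ∃ c, d = c + 1 := ⟨d - 1, by omega⟩
      have h1 := R1 h hX _ hy
      have h2 := R1 h hX _ ht
      refine lemmaD h h1 (v := y 1) ?_ i
      convert h2 using 2
      push_cast; ring

theorem exists_Opt {p : ℤ} {f M : ℕ} {N : ℕ → ℤ} (h : Dat p f M N) {X l : ZMod f → ℤ}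
    (d : ℕ) (hex : ∃ y, IsCh p N X d l y) : ∃ y, Opt p f M N X d l y := by
  obtain ⟨y, hy, hm⟩ := exists_max_int (fun y => IsCh p N X d l y)
    (fun y => ∑ j ∈ Finset.range d, TT p f M N (EE p (y j))) (∑ j ∈ Finset.range d, Phi p f M N)
    hex (fun y hy => Finset.sum_le_sum (fun j hj => T_le h
      (fun i => (hy.good j (Finset.mem_range.mp hj) i).1)))
  exact ⟨y, hy, hm⟩

end MZ

namespace MZ

theorem sum_dig (p : ℕ) (M : ℕ) : ∀ n, n < p ^ M →
    ∑ e ∈ Finset.range M, p ^ e * (n / p ^ e % p) = n := by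
  induction M with
  | zero => intro n hn; simp at hn; simp [hn]
  | succ M ih =>
    intro n hn
    rw [Finset.sum_range_succ']
    have h1 : n / p < p ^ M := Nat.div_lt_of_lt_mul (by rw [pow_succ'] at hn; exact hn)
    have h2 := ih (n / p) h1
    have h3 : ∑ k ∈ Finset.range M, p ^ (k + 1) * (n / p ^ (k + 1) % p) = p * (n / p) := by
      conv_rhs => rw [← h2]
      rw [Finset.mul_sum]
      apply Finset.sum_congr rfl
      intro k _
      rw [pow_succ', Nat.div_div_eq_div_mul]; ring
    rw [h3]
    simp [Nat.div_add_mod]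

theorem dig_sum (p : ℕ) (k : ℕ) : ∀ (M : ℕ) (h : ℕ → ℕ), (∀ e, h e < p) →
    (∀ e, M ≤ e → h e = 0) → (∑ e ∈ Finset.range M, p ^ e * h e) / p ^ k % p = h k := by
  induction k with
  | zero =>
    intro M h hh h0
    cases M with
    | zero => simp [h0 0]
    | succ M =>
      rw [Finset.sum_range_succ']
      have : ∑ k ∈ Finset.range M, p ^ (k + 1) * h (k + 1) =
          p * ∑ k ∈ Finset.range M, p ^ k * h (k + 1) := by
        rw [Finset.mul_sum]; exact Finset.sum_congr rfl (fun k _ => by ring)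
      rw [this]
      simp [Nat.mul_add_mod, Nat.mod_eq_of_lt (hh 0)]
  | succ k ih =>
    intro M h hh h0
    have hp : 0 < p := by have := hh 0; omega
    cases M with
    | zero => simp [h0 (k+1)]
    | succ M =>
      rw [Finset.sum_range_succ']
      have : ∑ k ∈ Finset.range M, p ^ (k + 1) * h (k + 1) =
          p * ∑ k ∈ Finset.range M, p ^ k * h (k + 1) := by
        rw [Finset.mul_sum]; exact Finset.sum_congr rfl (fun k _ => by ring)
      rw [this, pow_succ', ← Nat.div_div_eq_div_mul]
      have h1 : (p * ∑ k ∈ Finset.range M, p ^ k * h (k + 1) + p ^ 0 * h 0) / p =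
          ∑ k ∈ Finset.range M, p ^ k * h (k + 1) := by
        rw [pow_zero, one_mul, Nat.mul_add_div hp, Nat.div_eq_of_lt (hh 0), add_zero]
      rw [h1]
      exact ih M (fun e => h (e+1)) (fun e => hh _) (fun e he => h0 _ (by omega))

def NN (f M : ℕ) (g : ℕ → ℤ) (e : ℕ) : ℤ :=
  ∑ e' ∈ Finset.range M, if e ≤ e' ∧ (e' : ZMod f) = (e : ZMod f) then g e' else 0

def AA (p : ℤ) (f M : ℕ) (g : ℕ → ℤ) (i : ZMod f) : ℤ :=
  ∑ e ∈ Finset.range M, p ^ ((e : ZMod f) - i).val * g e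

def VV (p : ℤ) (M : ℕ) (g : ℕ → ℤ) : ℤ := ∑ e ∈ Finset.range M, p ^ e * g e

theorem NN_zero {f M : ℕ} (g : ℕ → ℤ) (e : ℕ) (he : M ≤ e) : NN f M g e = 0 :=
  Finset.sum_eq_zero (fun e' h => by
    rw [Finset.mem_range] at h
    rw [if_neg]; omega)

theorem NN_rec {f M : ℕ} (hf : 0 < f) (g : ℕ → ℤ) (e : ℕ) (he : e < M) :
    NN f M g e = g e + NN f M g (e + f) := by
  unfold NN
  have h1 : g e = ∑ e' ∈ Finset.range M, if e' = e then g e' else 0 := by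
    rw [Finset.sum_ite_eq' (Finset.range M) e g, if_pos (Finset.mem_range.mpr he)]
  rw [h1, ← Finset.sum_add_distrib]
  apply Finset.sum_congr rfl
  intro k _
  have hcf : ((e + f : ℕ) : ZMod f) = (e : ZMod f) := by simp
  rw [hcf]
  by_cases hk : (k : ZMod f) = (e : ZMod f)
  · by_cases hke : k = e
    · subst hke
      rw [if_pos ⟨le_rfl, rfl⟩, if_pos rfl, if_neg (by omega), add_zero]
    · simp only [hk, hke, and_true, if_false, zero_add]
      by_cases hle : e ≤ k
      · rw [if_pos hle, if_pos]
        rw [ZMod.natCast_eq_natCast_iff] at hk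
        obtain ⟨c, hc⟩ := (Nat.modEq_iff_dvd' hle).mp hk.symm
        have : c ≠ 0 := by rintro rfl; simp at hc; omega
        have : f * 1 ≤ f * c := Nat.mul_le_mul_left _ (by omega)
        omega
      · rw [if_neg hle, if_neg (by omega)]
  · have : k ≠ e := by rintro rfl; exact hk rfl
    simp [hk, this]

/-- uniqueness of the recursion -/
theorem NN_unique {f M : ℕ} (hf : 0 < f) (g F : ℕ → ℤ) (hF0 : ∀ e, M ≤ e → F e = 0)
    (hF : ∀ e, e < M → F e = g e + F (e + f)) (e : ℕ) : NN f M g e = F e := by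
  have key : ∀ k e, M ≤ e + k → NN f M g e = F e := by
    intro k
    induction k with
    | zero => intro e he; rw [NN_zero g e (by omega), hF0 e (by omega)]
    | succ k ih =>
      intro e he
      rcases lt_or_ge e M with h1 | h1
      · rw [NN_rec hf g e h1, hF e h1, ih (e + f) (by omega)]
      · rw [NN_zero g e h1, hF0 e h1]
  exact key M e (by omega)

theorem NN_val {f M : ℕ} [NeZero f] (g : ℕ → ℤ) (i : ZMod f) :
    NN f M g i.val = ∑ e ∈ Finset.range M, if (e : ZMod f) = i then g e else 0 := by
  unfold NN
  apply Finset.sum_congr rfl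
  intro k _
  rw [ZMod.natCast_zmod_val]
  by_cases hk : (k : ZMod f) = i
  · rw [if_pos hk, if_pos]
    refine ⟨?_, hk⟩
    rw [← hk, ZMod.val_natCast]; exact Nat.mod_le _ _
  · simp [hk]

theorem Phi_NN {p : ℤ} {f M : ℕ} (hf : 0 < f) (g : ℕ → ℤ) : Phi p f M (NN f M g) = VV p M g := by
  unfold Phi VV
  apply Finset.sum_congr rfl
  intro e he
  rw [NN_rec hf g e (Finset.mem_range.mp he)]
  ring

theorem pow_val {p : ℤ} {f : ℕ} [NeZero f] (x : ZMod f) :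
    p * p ^ (x - 1).val - p ^ x.val = if x = 0 then p ^ f - 1 else 0 := by
  have hf : 0 < f := NeZero.pos f
  split_ifs with h
  · subst h
    obtain ⟨g, rfl⟩ : ∃ g, f = g + 1 := ⟨f - 1, by omega⟩
    have : (0 - 1 : ZMod (g+1)).val = g := by
      rw [zero_sub]; exact ZMod.val_neg_one g
    rw [this]
    simp [pow_succ']
  · have h1 : 0 < x.val := by rw [Nat.pos_iff_ne_zero, Ne, ZMod.val_eq_zero]; exact h
    have h2 : (x - 1).val = x.val - 1 := by
      have h3 : x - 1 = ((x.val - 1 : ℕ) : ZMod f) := by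
        rw [Nat.cast_sub h1]; simp
      rw [h3, ZMod.val_natCast, Nat.mod_eq_of_lt]
      have := ZMod.val_lt x
      omega
    rw [h2, ← pow_succ', Nat.sub_add_cancel h1, sub_self]

theorem EE_AA {p : ℤ} {f M : ℕ} [NeZero f] (g : ℕ → ℤ) (i : ZMod f) :
    EE p (AA p f M g) i = (p ^ f - 1) * NN f M g i.val := by
  rw [NN_val]
  unfold EE AA
  rw [Finset.mul_sum, Finset.mul_sum, ← Finset.sum_sub_distrib]
  apply Finset.sum_congr rfl
  intro e _
  have := pow_val (p := p) ((e : ZMod f) - i)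
  rw [sub_sub] at this
  simp only [sub_eq_zero] at this
  rw [← mul_assoc, ← sub_mul, this]
  split_ifs <;> simp

theorem AA_dvd_iff {p : ℤ} {f M : ℕ} [NeZero f] (g : ℕ → ℤ) :
    (p ^ f - 1) ∣ AA p f M g 0 ↔ (p ^ f - 1) ∣ VV p M g := by
  have : (p ^ f - 1) ∣ VV p M g - AA p f M g 0 := by
    unfold VV AA
    rw [← Finset.sum_sub_distrib]
    apply Finset.dvd_sum
    intro e _
    rw [sub_zero, ZMod.val_natCast, ← sub_mul]
    apply Dvd.dvd.mul_right
    have h1 : p ^ e - p ^ (e % f) = p ^ (e % f) * ((p ^ f) ^ (e / f) - 1) := by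
      rw [mul_sub, ← pow_mul, ← pow_add, mul_one, Nat.mod_add_div]
    rw [h1]
    apply Dvd.dvd.mul_left
    simpa using sub_dvd_pow_sub_pow (p ^ f) 1 (e / f)
  constructor
  · intro h; have := dvd_add this h; simpa using this
  · intro h; have := dvd_sub h this; simpa using this

theorem AA_dvd {p : ℤ} {f M : ℕ} [NeZero f] (g : ℕ → ℤ) (h : (p ^ f - 1) ∣ VV p M g) (i : ZMod f) :
    (p ^ f - 1) ∣ AA p f M g i := by
  have key : ∀ n : ℕ, (p ^ f - 1) ∣ AA p f M g (-(n : ZMod f)) := by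
    intro n
    induction n with
    | zero => simpa using (AA_dvd_iff g).mpr h
    | succ n ih =>
      have h1 := EE_AA (p := p) (M := M) g (-((n + 1 : ℕ) : ZMod f))
      simp only [EE] at h1
      have h2 : -((n + 1 : ℕ) : ZMod f) + 1 = -(n : ZMod f) := by push_cast; ring
      rw [h2] at h1
      have h3 : AA p f M g (-((n + 1 : ℕ) : ZMod f)) = p * AA p f M g (-(n : ZMod f)) -
        (p ^ f - 1) * NN f M g (-((n + 1 : ℕ) : ZMod f)).val := by linarith
      rw [h3]
      exact dvd_sub (ih.mul_left _) (dvd_mul_right _ _)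
  have := key (-i).val
  simpa using this

theorem AA_mono {p : ℤ} {f M : ℕ} (hp : 1 ≤ p) (g h : ℕ → ℤ) (gh : ∀ e, g e ≤ h e) (i : ZMod f) :
    AA p f M g i ≤ AA p f M h i :=
  Finset.sum_le_sum (fun e _ => mul_le_mul_of_nonneg_left (gh e) (by positivity))

theorem NN_mono {f M : ℕ} (g h : ℕ → ℤ) (gh : ∀ e, g e ≤ h e) (e : ℕ) :
    NN f M g e ≤ NN f M h e :=
  Finset.sum_le_sum (fun e _ => by split_ifs; exact gh e; exact le_rfl)

theorem NN_nonneg {f M : ℕ} (g : ℕ → ℤ) (h : ∀ e, 0 ≤ g e) (e : ℕ) :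
    0 ≤ NN f M g e :=
  Finset.sum_nonneg (fun e _ => by split_ifs; exact h e; exact le_rfl)

theorem NN_le_val {f M : ℕ} [NeZero f] (g : ℕ → ℤ) (h : ∀ e, 0 ≤ g e) (e : ℕ) :
    NN f M g e ≤ NN f M g (e : ZMod f).val := by
  rw [NN_val]
  apply Finset.sum_le_sum
  intro k _
  have := h k
  split_ifs with h1 h2 h2
  · exact le_rfl
  · exact absurd h1.2 h2
  · exact this
  · exact le_rfl

theorem AA_sub {p : ℤ} {f M : ℕ} (g h : ℕ → ℤ) (i : ZMod f) :
    AA p f M (fun e => g e - h e) i = AA p f M g i - AA p f M h i := by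
  unfold AA; rw [← Finset.sum_sub_distrib]
  exact Finset.sum_congr rfl (fun e _ => by ring)

theorem VV_sub {p : ℤ} {M : ℕ} (g h : ℕ → ℤ) :
    VV p M (fun e => g e - h e) = VV p M g - VV p M h := by
  unfold VV; rw [← Finset.sum_sub_distrib]
  exact Finset.sum_congr rfl (fun e _ => by ring)

theorem AA_pos_iff {p : ℤ} {f M : ℕ} (hp : 1 ≤ p) (g : ℕ → ℤ) (h : ∀ e, 0 ≤ g e) (i : ZMod f) :
    0 < AA p f M g i ↔ 0 < VV p M g := by
  unfold AA VV
  rw [Finset.sum_pos_iff_of_nonneg (fun e _ => mul_nonneg (by positivity) (h e)),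
    Finset.sum_pos_iff_of_nonneg (fun e _ => mul_nonneg (by positivity) (h e))]
  have hp' : 0 < p := by linarith
  constructor
  · rintro ⟨e, he, h1⟩
    exact ⟨e, he, mul_pos (by positivity) (pos_of_mul_pos_right h1 (by positivity))⟩
  · rintro ⟨e, he, h1⟩
    exact ⟨e, he, mul_pos (by positivity) (pos_of_mul_pos_right h1 (by positivity))⟩

end MZ

namespace MZ

def gd (p n e : ℕ) : ℤ := ((n / p ^ e % p : ℕ) : ℤ)

def DL (p m n : ℕ) : Prop := ∀ e, m / p ^ e % p ≤ n / p ^ e % p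

def Step (p q n m : ℕ) : Prop := m < n ∧ (q - 1) ∣ (n - m) ∧ DL p m n

def IsChain (p q d n : ℕ) (c : ℕ → ℕ) : Prop := c 0 = n ∧ ∀ j, j < d → Step p q (c j) (c (j + 1))

theorem VV_gd {p n M : ℕ} (h : n < p ^ M) : VV p M (gd p n) = n := by
  unfold VV gd
  conv_rhs => rw [← sum_dig p M n h]
  push_cast
  rfl

theorem gd_nonneg (p n e : ℕ) : 0 ≤ gd p n e := by unfold gd; positivity

theorem Dat_gd {p f n M : ℕ} (hp : 2 ≤ p) (hf : 0 < f) : Dat p f M (NN f M (gd p n)) := by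
  refine ⟨by exact_mod_cast hp, hf, fun e he => NN_zero _ _ he, ?_, ?_⟩
  · intro e
    rcases lt_or_ge e M with h | h
    · rw [NN_rec hf _ e h]; have := gd_nonneg p n e; linarith
    · rw [NN_zero _ e h, NN_zero _ _ (by omega)]
  · intro e
    rcases lt_or_ge e M with h | h
    · rw [NN_rec hf _ e h]
      have : gd p n e < p := by unfold gd; exact_mod_cast Nat.mod_lt _ (by omega)
      linarith
    · rw [NN_zero _ e h, NN_zero _ _ (by omega)]; 
      have : (2:ℤ) ≤ p := by exact_mod_cast hp
      linarith

def XX (p f M n : ℕ) (i : ZMod f) : ℤ := AA p f M (gd p n) i / ((p : ℤ) ^ f - 1)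

theorem q_pos {p f : ℕ} (hp : 2 ≤ p) (hf : 0 < f) : (0 : ℤ) < (p : ℤ) ^ f - 1 := by
  have : (1 : ℤ) < (p : ℤ) ^ f := one_lt_pow₀ (by exact_mod_cast hp) (by omega)
  linarith

theorem EE_XX {p f M n : ℕ} [NeZero f] (hp : 2 ≤ p) (i : ZMod f) :
    EE p (XX p f M n) i ≤ NN f M (gd p n) i.val := by
  have hq := q_pos hp (NeZero.pos f)
  have h1 := EE_AA (p := p) (M := M) (gd p n) i
  simp only [EE] at *
  have h2 : XX p f M n (i+1) * ((p : ℤ) ^ f - 1) ≤ AA p f M (gd p n) (i+1) :=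
    Int.ediv_mul_le _ hq.ne'
  have h3 : p * XX p f M n (i+1) - NN f M (gd p n) i.val ≤ XX p f M n i := by
    unfold XX at *
    rw [Int.le_ediv_iff_mul_le hq]
    have h4 := mul_le_mul_of_nonneg_left h2 (show (0:ℤ) ≤ p by positivity)
    nlinarith
  linarith

theorem chain_anti {p q d n : ℕ} {c : ℕ → ℕ} (hc : IsChain p q d n c) :
    ∀ j, j ≤ d → c j ≤ n ∧ DL p (c j) n ∧ (q - 1) ∣ n - c j := by
  intro j
  induction j with
  | zero => intro _; rw [hc.1]; exact ⟨le_rfl, fun e => le_rfl, by simp⟩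
  | succ j ih =>
    intro hj
    obtain ⟨h1, h2, h3⟩ := ih (by omega)
    obtain ⟨h4, h5, h6⟩ := hc.2 j (by omega)
    refine ⟨by omega, fun e => (h6 e).trans (h2 e), ?_⟩
    have : n - c (j+1) = (n - c j) + (c j - c (j+1)) := by omega
    rw [this]; exact dvd_add h3 h5

/-- from true chains to abstract chains -/
theorem link1 {p f M n d : ℕ} [NeZero f] (hp : 2 ≤ p) (hn : n < p ^ M) {c : ℕ → ℕ}
    (hc : IsChain p (p ^ f) d n c) :
    ∃ y, IsCh p (NN f M (gd p n)) (XX p f M n) d (fun _ => 1) y ∧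
      ∀ j, j < d → (n : ℤ) - c (j + 1) ≤ TT p f M (NN f M (gd p n)) (EE p (y j)) := by
  have hf := NeZero.pos f
  have hq := q_pos hp hf
  have hD := Dat_gd (n := n) (M := M) hp hf
  have hp1 : (1 : ℤ) ≤ p := by exact_mod_cast (by omega : 1 ≤ p)
  have hqc : ((p ^ f - 1 : ℕ) : ℤ) = (p : ℤ) ^ f - 1 := by
    rw [Nat.cast_sub (Nat.one_le_pow _ _ (by omega))]; push_cast; rfl
  set gm : ℕ → ℕ → ℤ := fun j e => gd p n e - gd p (c j) e with hgm
  have hcn := chain_anti hc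
  have gm0 : ∀ j, j ≤ d → ∀ e, 0 ≤ gm j e := fun j hj e => by
    have := (hcn j hj).2.1 e
    simp only [hgm, gd]
    have : ((c j / p ^ e % p : ℕ) : ℤ) ≤ ((n / p ^ e % p : ℕ) : ℤ) := by exact_mod_cast this
    linarith
  have gmn : ∀ j, ∀ e, gm j e ≤ gd p n e := fun j e => by
    have := gd_nonneg p (c j) e
    simp only [hgm]; linarith
  have hV : ∀ j, j ≤ d → VV p M (gm j) = n - c j := fun j hj => by
    simp only [hgm]
    rw [VV_sub, VV_gd hn, VV_gd (lt_of_le_of_lt (hcn j hj).1 hn)]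
  have hdv : ∀ j, j ≤ d → ∀ i, ((p:ℤ) ^ f - 1) ∣ AA p f M (gm j) i := fun j hj i => by
    apply AA_dvd
    rw [hV j hj, ← hqc]
    have := (hcn j hj).2.2
    have := Int.natCast_dvd_natCast.mpr this
    rwa [Nat.cast_sub (hcn j hj).1] at this
  set y : ℕ → ZMod f → ℤ := fun j i => AA p f M (gm (j+1)) i / ((p:ℤ) ^ f - 1) with hy
  have hAy : ∀ j, j < d → ∀ i, AA p f M (gm (j+1)) i = ((p:ℤ) ^ f - 1) * y j i := fun j hj i =>
    (Int.mul_ediv_cancel' (hdv (j+1) hj i)).symm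
  have hEy : ∀ j, j < d → ∀ i, EE p (y j) i = NN f M (gm (j+1)) i.val := fun j hj i => by
    have h1 := EE_AA (p := p) (M := M) (gm (j+1)) i
    have h2 : EE p (AA p f M (gm (j+1))) i = ((p:ℤ) ^ f - 1) * EE p (y j) i := by
      simp only [EE]; rw [hAy j hj, hAy j hj]; ring
    rw [h2] at h1
    exact mul_left_cancel₀ hq.ne' h1
  have hstep : ∀ j, j + 1 < d → ∀ i, y j i + 1 ≤ y (j + 1) i := by
    intro j hj i
    obtain ⟨h1, h2, h3⟩ := hc.2 (j+1) (by omega)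
    have hnn : ∀ e, 0 ≤ (fun e => gm (j+1+1) e - gm (j+1) e) e := by
      intro e
      have := h3 e
      simp only [hgm, gd]
      have : ((c (j+1+1) / p ^ e % p : ℕ) : ℤ) ≤ ((c (j+1) / p ^ e % p : ℕ) : ℤ) := by
        exact_mod_cast this
      linarith
    have h4 := (AA_pos_iff (M := M) hp1 _ hnn i).mpr (by
      rw [VV_sub, hV _ (by omega), hV _ (by omega)]
      have : (c (j+1+1) : ℤ) < c (j+1) := by exact_mod_cast h1
      linarith)
    rw [AA_sub, hAy j (by omega), hAy (j+1) hj, ← mul_sub] at h4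
    have := pos_of_mul_pos_right h4 hq.le
    omega
  have hyX : ∀ j, j < d → ∀ i, y j i ≤ XX p f M n i := by
    intro j hj i
    unfold XX
    rw [Int.le_ediv_iff_mul_le hq, mul_comm, ← hAy j hj]
    exact AA_mono hp1 _ _ (gmn _) i
  refine ⟨y, ⟨?_, ?_, hstep, ?_⟩, ?_⟩
  · intro j hj i
    rw [hEy j hj]
    exact ⟨NN_nonneg _ (gm0 _ (by omega)) _, NN_mono _ _ (gmn _) _⟩
  · intro hd i
    have h4 := (AA_pos_iff (M := M) hp1 _ (gm0 1 (by omega)) i).mpr (by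
      rw [hV _ (by omega)]
      have := (hc.2 0 hd).1
      rw [hc.1] at this
      have : (c (0+1) : ℤ) < n := by exact_mod_cast this
      simp only [zero_add] at this
      linarith)
    have := hAy 0 hd i
    simp only [zero_add] at this
    rw [this] at h4
    have := pos_of_mul_pos_right h4 hq.le
    omega
  · have key : ∀ k j, j + k + 1 = d → ∀ i, y j i + k ≤ XX p f M n i := by
      intro k
      induction k with
      | zero => intro j hj i; simpa using hyX j (by omega) i
      | succ k ih =>
        intro j hj i
        have := ih (j+1) (by omega) i
        have := hstep j (by omega) i
        push_cast; linarith
    intro j hj i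
    have := key (d - 1 - j) j (by omega) i
    have h2 : ((d - 1 - j : ℕ) : ℤ) = (d : ℤ) - 1 - j := by omega
    rw [h2] at this
    exact this
  · intro j hj
    rw [← hV (j+1) (by omega), ← Phi_NN hf]
    unfold TT
    apply Phi_mono hp1
    · intro e
      rw [hEy j hj]
      exact le_min (NN_le_val _ (gm0 _ (by omega)) _) (NN_mono _ _ (gmn _) _)
    · intro e he
      rw [hEy j hj, NN_zero _ e he, NN_zero _ e he]
      exact (min_eq_right (NN_nonneg _ (gm0 _ (by omega)) _)).symm

/-- from optimal abstract chains to true chains -/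
theorem link2 {p f M n d : ℕ} [NeZero f] (hp : 2 ≤ p) (hn : n < p ^ M) {y : ℕ → ZMod f → ℤ}
    (hy : Opt p f M (NN f M (gd p n)) (XX p f M n) d (fun _ => 1) y) :
    ∃ c, IsChain p (p ^ f) d n c ∧
      ∀ j, j < d → (n : ℤ) - c (j + 1) = TT p f M (NN f M (gd p n)) (EE p (y j)) := by
  have hf := NeZero.pos f
  have hq := q_pos hp hf
  have hD := Dat_gd (n := n) (M := M) hp hf
  have hp1 : (1 : ℤ) ≤ p := by exact_mod_cast (by omega : 1 ≤ p)
  have hqc : ((p ^ f - 1 : ℕ) : ℤ) = (p : ℤ) ^ f - 1 := by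
    rw [Nat.cast_sub (Nat.one_le_pow _ _ (by omega))]; push_cast; rfl
  have hmono := R2 hD (EE_XX hp) d _ y hy
  set N := NN f M (gd p n) with hN
  have hcf : ∀ k : ℕ, ((k + f : ℕ) : ZMod f) = (k : ZMod f) := fun k => by simp
  -- g j are the digits of m_{j}, with m_0 = 0
  obtain ⟨g, hg0, hgs⟩ : ∃ g : ℕ → ℕ → ℤ, (∀ e, g 0 e = 0) ∧ ∀ j e, g (j+1) e =
      min (EE p (y j) e) (N e) - min (EE p (y j) e) (N (e + f)) :=
    ⟨fun j e => Nat.casesOn j 0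
      (fun j => min (EE p (y j) e) (N e) - min (EE p (y j) e) (N (e + f))),
      fun e => rfl, fun j e => rfl⟩
  have hNd : ∀ e, N e - N (e + f) ≤ gd p n e := by
    intro e
    rcases lt_or_ge e M with h | h
    · rw [hN, NN_rec hf _ e h]; linarith
    · rw [hN, NN_zero _ e h, NN_zero _ _ (by omega)]; have := gd_nonneg p n e; linarith
  have gnn : ∀ j e, 0 ≤ g j e := by
    intro j e
    cases j with
    | zero => rw [hg0]
    | succ j => rw [hgs]; have := hD.lo e; omega
  have gle : ∀ j e, g j e ≤ gd p n e := by
    intro j e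
    cases j with
    | zero => rw [hg0]; exact gd_nonneg p n e
    | succ j => rw [hgs]; have := hD.lo e; have := hNd e; omega
  have gmono : ∀ j, j < d → ∀ e, g j e ≤ g (j+1) e := by
    intro j hj e
    cases j with
    | zero => rw [hg0]; exact gnn (0+1) e
    | succ j =>
      rw [hgs, hgs]; have := hD.lo e; have := hmono j hj e
      omega
  have hNg : ∀ j, j < d → ∀ e, NN f M (g (j+1)) e = min (EE p (y j) e) (N e) := by
    intro j hj e
    apply NN_unique hf (g (j+1)) (fun e => min (EE p (y j) e) (N e))
    · intro e he
      rw [hD.hM e he]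
      exact min_eq_right (hy.ch.good j hj e).1
    · intro e he
      rw [hgs, hcf]; ring
  have hA : ∀ j, j < d → ∀ i, AA p f M (g (j+1)) i = ((p:ℤ)^f - 1) * y j i := by
    intro j hj i
    refine congrFun (EE_inj hD.hp (AA p f M (g (j+1))) (fun i => ((p:ℤ)^f - 1) * y j i) ?_) i
    intro i
    rw [EE_AA, hNg j hj, ZMod.natCast_zmod_val, min_eq_left (hy.ch.good j hj i).2]
    simp only [EE]; ring
  have hVT : ∀ j, VV p M (g (j+1)) = TT p f M N (EE p (y j)) := by
    intro j
    unfold VV TT Phi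
    apply Finset.sum_congr rfl
    intro e _
    beta_reduce
    rw [hgs, hcf]
  have hdvd : ∀ j, j ≤ d → ((p:ℤ)^f - 1) ∣ VV p M (g j) := by
    intro j hj
    cases j with
    | zero => simp [VV, hg0]
    | succ j => rw [← AA_dvd_iff (f := f), hA j hj]; exact dvd_mul_right _ _
  have hVlt : ∀ j, j < d → VV p M (g j) < VV p M (g (j+1)) := by
    intro j hj
    have h1 : 0 < AA p f M (fun e => g (j+1) e - g j e) 0 := by
      rw [AA_sub, hA j hj]
      cases j with
      | zero =>
        have h2 : AA p f M (g 0) 0 = 0 := by simp [AA, hg0]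
        rw [h2, sub_zero]
        have := hy.ch.lo (by omega) 0
        exact mul_pos hq (by linarith)
      | succ j =>
        rw [hA j (by omega), ← mul_sub]
        have := hy.ch.step j hj 0
        exact mul_pos hq (by linarith)
    rw [AA_pos_iff hp1 _ (fun e => by have := gmono j hj e; linarith), VV_sub] at h1
    linarith
  -- the digits of the complement
  obtain ⟨hc, hhc⟩ : ∃ hc : ℕ → ℕ → ℕ, hc = fun j e => if e < M then (gd p n e - g j e).toNat else 0 :=
    ⟨_, rfl⟩
  have hcc : ∀ j e, e < M → (hc j e : ℤ) = gd p n e - g j e := by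
    intro j e he
    simp only [hhc, if_pos he]
    exact Int.toNat_of_nonneg (by have := gle j e; linarith)
  have hclt : ∀ j e, hc j e < p := by
    intro j e
    rcases lt_or_ge e M with h | h
    · have h1 := hcc j e h
      have : gd p n e < p := by unfold gd; exact_mod_cast Nat.mod_lt _ (by omega)
      have := gnn j e
      have : (hc j e : ℤ) < p := by linarith
      exact_mod_cast this
    · simp only [hhc, if_neg (not_lt.mpr h)]; omega
  have hcz : ∀ j e, M ≤ e → hc j e = 0 := fun j e he => by
    simp only [hhc, if_neg (not_lt.mpr he)]
  obtain ⟨c, hcdef⟩ : ∃ c : ℕ → ℕ, c = fun j => ∑ e ∈ Finset.range M, p ^ e * hc j e := ⟨_, rfl⟩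
  have hcdig : ∀ j e, c j / p ^ e % p = hc j e := fun j e => by
    rw [hcdef]
    exact dig_sum p e M (hc j) (hclt j) (hcz j)
  have hcV : ∀ j, (c j : ℤ) = n - VV p M (g j) := by
    intro j
    rw [← VV_gd hn, ← VV_sub]
    simp only [hcdef, VV]
    push_cast
    apply Finset.sum_congr rfl
    intro e he
    rw [hcc j e (Finset.mem_range.mp he)]
  refine ⟨c, ⟨?_, ?_⟩, ?_⟩
  · have := hcV 0
    have h2 : VV p M (g 0) = 0 := by simp [VV, hg0]
    rw [h2, sub_zero] at this
    exact_mod_cast this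
  · intro j hj
    have h1 := hcV j
    have h2 := hcV (j+1)
    have h3 := hVlt j hj
    have h4 : c (j+1) < c j := by
      have : (c (j+1) : ℤ) < c j := by linarith
      exact_mod_cast this
    refine ⟨h4, ?_, ?_⟩
    · rw [← Int.natCast_dvd_natCast, hqc, Nat.cast_sub h4.le, h1, h2]
      have := dvd_sub (hdvd (j+1) hj) (hdvd j hj.le)
      rwa [sub_sub_sub_cancel_left]
    · intro e
      rw [hcdig, hcdig]
      rcases lt_or_ge e M with h | h
      · have a1 := hcc j e h
        have a2 := hcc (j+1) e h
        have a3 := gmono j hj e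
        have : (hc (j+1) e : ℤ) ≤ hc j e := by linarith
        exact_mod_cast this
      · rw [hcz _ e h, hcz _ e h]
  · intro j hj
    rw [hcV, hVT]; ring

theorem chain_iff {p f M n d : ℕ} [NeZero f] (hp : 2 ≤ p) (hn : n < p ^ M) :
    (∃ c, IsChain p (p ^ f) d n c) ↔ ∀ i : ZMod f, (d : ℤ) * ((p : ℤ) ^ f - 1) ≤ AA p f M (gd p n) i := by
  have hf := NeZero.pos f
  have hq := q_pos hp hf
  have hD := Dat_gd (n := n) (M := M) hp hf
  constructor
  · rintro ⟨c, hc⟩ i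
    obtain ⟨y, hy, -⟩ := link1 hp hn hc
    rw [← Int.le_ediv_iff_mul_le hq]
    rcases Nat.eq_zero_or_pos d with rfl | hd
    · apply Int.ediv_nonneg _ hq.le
      exact Finset.sum_nonneg (fun e _ => mul_nonneg (by positivity) (gd_nonneg _ _ _))
    · have h1 := hy.lo hd i
      have h2 := hy.hi 0 hd i
      simp only [XX] at h2
      push_cast at h2
      linarith
  · intro h
    obtain ⟨y, hy⟩ := exists_Opt hD d (exists_IsCh hD.hp (N_nonneg hD) (XX p f M n) (EE_XX hp) d
      (fun i => by unfold XX; rw [Int.le_ediv_iff_mul_le hq]; exact h i))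
    obtain ⟨c, hc, -⟩ := link2 hp hn hy
    exact ⟨c, hc⟩

theorem chain_min_unique {p f n d : ℕ} (hf : 0 < f) (hp : 2 ≤ p) {c c' : ℕ → ℕ}
    (hc : IsChain p (p ^ f) (d + 1) n c) (hc' : IsChain p (p ^ f) (d + 1) n c')
    (hm : ∀ b, IsChain p (p ^ f) (d + 1) n b →
      ∑ j ∈ Finset.range (d + 1), c (j + 1) ≤ ∑ j ∈ Finset.range (d + 1), b (j + 1))
    (hm' : ∀ b, IsChain p (p ^ f) (d + 1) n b →
      ∑ j ∈ Finset.range (d + 1), c' (j + 1) ≤ ∑ j ∈ Finset.range (d + 1), b (j + 1)) :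
    c 1 = c' 1 := by
  have : NeZero f := ⟨hf.ne'⟩
  have hn : n < p ^ n := Nat.lt_pow_self (by omega)
  have hD := Dat_gd (n := n) (M := n) hp hf
  have key : ∀ c, IsChain p (p ^ f) (d + 1) n c → (∀ b, IsChain p (p ^ f) (d + 1) n b →
      ∑ j ∈ Finset.range (d + 1), c (j + 1) ≤ ∑ j ∈ Finset.range (d + 1), b (j + 1)) →
      ∃ y, Opt p f n (NN f n (gd p n)) (XX p f n n) (d + 1) (fun _ => 1) y ∧
        (n : ℤ) - c 1 = TT p f n (NN f n (gd p n)) (EE p (y 0)) := by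
    intro c hc hm
    obtain ⟨y, hy, hle⟩ := link1 hp hn hc
    obtain ⟨ys, hys⟩ := exists_Opt hD (d + 1) ⟨y, hy⟩
    obtain ⟨b, hb, hbe⟩ := link2 hp hn hys
    have h1 : ∑ j ∈ Finset.range (d + 1), ((n : ℤ) - c (j + 1)) ≤
        ∑ j ∈ Finset.range (d + 1), TT p f n (NN f n (gd p n)) (EE p (y j)) :=
      Finset.sum_le_sum (fun j hj => hle j (Finset.mem_range.mp hj))
    have h2 := hys.opt y hy
    have h3 : ∑ j ∈ Finset.range (d + 1), ((n : ℤ) - b (j + 1)) =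
        ∑ j ∈ Finset.range (d + 1), TT p f n (NN f n (gd p n)) (EE p (ys j)) :=
      Finset.sum_congr rfl (fun j hj => hbe j (Finset.mem_range.mp hj))
    have h4 : (∑ j ∈ Finset.range (d + 1), (c (j + 1) : ℤ)) ≤
        ∑ j ∈ Finset.range (d + 1), (b (j + 1) : ℤ) := by exact_mod_cast hm b hb
    rw [Finset.sum_sub_distrib] at h1 h3
    refine ⟨y, ⟨hy, fun z hz => (hys.opt z hz).trans (by linarith)⟩, ?_⟩
    have h5 := (Finset.sum_eq_sum_iff_of_le (s := Finset.range (d+1))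
      (f := fun j => (n : ℤ) - c (j + 1))
      (g := fun j => TT p f n (NN f n (gd p n)) (EE p (y j)))
      (fun j hj => hle j (Finset.mem_range.mp hj))).mp (by
        rw [Finset.sum_sub_distrib]; linarith) 0 (by simp)
    simpa using h5
  obtain ⟨y, hy, h1⟩ := key c hc hm
  obtain ⟨y', hy', h2⟩ := key c' hc' hm'
  have := R3 hD (EE_XX hp) d hy hy'
  rw [this] at h1
  have : (c 1 : ℤ) = c' 1 := by linarith
  exact_mod_cast this

end MZ

namespace MZ

theorem sum_dig_mod (p : ℕ) (M n : ℕ) :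
    ∑ e ∈ Finset.range M, p ^ e * (n / p ^ e % p) = n % p ^ M := by
  induction M with
  | zero => simp [Nat.mod_one]
  | succ M ih => rw [Finset.sum_range_succ, ih, Nat.mod_pow_succ]

theorem digits_sum_rec (q N : ℕ) (hq : 2 ≤ q) :
    (Nat.digits q N).sum = N % q + (Nat.digits q (N / q)).sum := by
  rcases Nat.eq_zero_or_pos N with rfl | hN
  · simp
  · rw [Nat.digits_def' (by omega) hN]; simp

theorem digits_sum (p f : ℕ) (hp : 2 ≤ p) (hf : 0 < f) (K : ℕ) : ∀ N, N < (p ^ f) ^ K →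
    (Nat.digits (p ^ f) N).sum = ∑ e ∈ Finset.range (f * K), p ^ (e % f) * (N / p ^ e % p) := by
  have hq : 2 ≤ p ^ f := hp.trans (Nat.le_self_pow (by omega) p)
  induction K with
  | zero => intro N hN; simp at hN; simp [hN]
  | succ K ih =>
    intro N hN
    rw [digits_sum_rec _ _ hq, Nat.mul_succ, add_comm (f * K) f, Finset.sum_range_add]
    rw [ih (N / p ^ f) (Nat.div_lt_of_lt_mul (by rw [pow_succ'] at hN; exact hN)), ← sum_dig_mod]
    congr 1
    · apply Finset.sum_congr rfl
      intro e he
      rw [Nat.mod_eq_of_lt (Finset.mem_range.mp he)]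
    · apply Finset.sum_congr rfl
      intro e he
      rw [Nat.add_mod_left, Nat.div_div_eq_div_mul, pow_add]

theorem digits_AA {p f k : ℕ} [NeZero f] (hp : 2 ≤ p) (i : ℕ) :
    ((Nat.digits (p ^ f) (k * p ^ i)).sum : ℤ) = AA p f k (gd p k) (-(i : ZMod f)) := by
  have hf := NeZero.pos f
  have hq : 2 ≤ p ^ f := hp.trans (Nat.le_self_pow (by omega) p)
  have hk : k < p ^ k := Nat.lt_pow_self (by omega)
  rw [digits_sum p f hp hf (k * p ^ i + k + i) _ (lt_of_lt_of_le (Nat.lt_pow_self (by omega))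
    (Nat.pow_le_pow_right (n := p ^ f) (by omega) (by omega : k * p ^ i ≤ k * p ^ i + k + i)))]
  obtain ⟨x, hx⟩ : ∃ x, f * (k * p ^ i + k + i) = i + (k + x) := by
    have : 1 * (k * p ^ i + k + i) ≤ f * (k * p ^ i + k + i) := Nat.mul_le_mul_right _ hf
    exact ⟨f * (k * p ^ i + k + i) - i - k, by omega⟩
  have hpos : 0 < p := by omega
  rw [hx, Finset.sum_range_add, Finset.sum_range_add]
  have h1 : ∑ e ∈ Finset.range i, p ^ (e % f) * (k * p ^ i / p ^ e % p) = 0 := by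
    apply Finset.sum_eq_zero
    intro e he
    rw [Finset.mem_range] at he
    have : k * p ^ i = (k * p ^ (i - e - 1) * p) * p ^ e := by
      rw [mul_assoc, mul_assoc, ← pow_succ', ← pow_add]; congr 2; omega
    rw [this, Nat.mul_div_cancel _ (by positivity), Nat.mul_mod_left, mul_zero]
  have hd : ∀ e, k * p ^ i / p ^ (i + e) = k / p ^ e := by
    intro e
    rw [pow_add, ← Nat.div_div_eq_div_mul, Nat.mul_div_cancel _ (by positivity)]
  have h2 : ∑ e ∈ Finset.range x, p ^ ((i + (k + e)) % f) *
      (k * p ^ i / p ^ (i + (k + e)) % p) = 0 := by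
    apply Finset.sum_eq_zero
    intro e he
    rw [hd, Nat.div_eq_of_lt, Nat.zero_mod, mul_zero]
    exact lt_of_lt_of_le hk (Nat.pow_le_pow_right hpos (by omega))
  rw [h1, h2, zero_add, add_zero]
  unfold AA gd
  push_cast
  apply Finset.sum_congr rfl
  intro e _
  have h3 : ((e : ZMod f) - -(i : ZMod f)) = ((i + e : ℕ) : ZMod f) := by push_cast; ring
  rw [h3, ZMod.val_natCast]
  have := hd e
  congr 1
  exact_mod_cast congrArg (fun z => ((z % p : ℕ) : ℤ)) this

theorem chain_iff_L (p f : ℕ) (hp : 2 ≤ p) (hf : 0 < f) (n d : ℕ) :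
    (∃ c, IsChain p (p ^ f) d n c) ↔ ∀ i ∈ Finset.range f,
      (d : ℚ) ≤ ((Nat.digits (p ^ f) (n * p ^ i)).sum : ℚ) / ((p : ℚ) ^ f - 1) := by
  have : NeZero f := ⟨hf.ne'⟩
  have hq : (0 : ℚ) < (p : ℚ) ^ f - 1 := by exact_mod_cast q_pos hp hf
  have hn : n < p ^ n := Nat.lt_pow_self (by omega)
  rw [chain_iff hp hn]
  have key : ∀ i : ℕ, ((d : ℚ) ≤ ((Nat.digits (p ^ f) (n * p ^ i)).sum : ℚ) / ((p : ℚ) ^ f - 1)) ↔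
      (d : ℤ) * ((p : ℤ) ^ f - 1) ≤ AA p f n (gd p n) (-(i : ZMod f)) := by
    intro i
    rw [← digits_AA hp, le_div_iff₀ hq]
    generalize (Nat.digits (p ^ f) (n * p ^ i)).sum = s
    rw [← Int.cast_le (R := ℚ)]
    push_cast
    exact Iff.rfl
  constructor
  · intro h i _
    exact (key i).mpr (h _)
  · intro h i
    have := (key (-i).val).mp (h _ (Finset.mem_range.mpr (ZMod.val_lt _)))
    simpa using this

end MZ

namespace MZ

theorem small_choose {p a b : ℕ} (hp : p.Prime) (ha : a < p) : p ∣ a.choose b ↔ a < b := by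
  constructor
  · intro h
    by_contra hb
    push Not at hb
    have h1 := Nat.choose_mul_factorial_mul_factorial hb
    have h2 : p ∣ a.factorial := by
      rw [← h1, mul_assoc]; exact Dvd.dvd.mul_right h _
    have := (Nat.Prime.dvd_factorial hp).mp h2
    omega
  · intro h
    rw [Nat.choose_eq_zero_of_lt h]; exact dvd_zero _

theorem lucas_DL {p m n : ℕ} (hp : p.Prime) : ¬ p ∣ n.choose m ↔ DL p m n := by
  have := Fact.mk hp
  have hn : n < p ^ (n + m) := lt_of_lt_of_le (Nat.lt_pow_self hp.one_lt) (Nat.pow_le_pow_right hp.pos (by omega))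
  have hm : m < p ^ (n + m) := lt_of_lt_of_le (Nat.lt_pow_self hp.one_lt) (Nat.pow_le_pow_right hp.pos (by omega))
  have h := Choose.choose_modEq_prod_range_choose_nat hn hm
  rw [(Nat.ModEq.dvd_iff h dvd_rfl), Prime.dvd_finsetProd_iff hp.prime]
  unfold DL
  push Not
  constructor
  · intro h e
    by_cases he : e < n + m
    · have := h e (Finset.mem_range.mpr he)
      rw [small_choose hp (Nat.mod_lt _ hp.pos)] at this
      omega
    · have : m / p ^ e = 0 := Nat.div_eq_of_lt (lt_of_lt_of_le hm (Nat.pow_le_pow_right hp.pos (by omega)))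
      simp [this]
  · intro h e _
    rw [small_choose hp (Nat.mod_lt _ hp.pos)]
    have := h e
    omega

section
variable {p f : ℕ} (hp : p.Prime) (hf : 0 < f) {Fq : Type} [Field Fq] [Fintype Fq]
  (hcard : Fintype.card Fq = p ^ f)

theorem charP_of (Fq : Type) [Field Fq] [Fintype Fq] {p f : ℕ} (hp : p.Prime) 
    (hcard : Fintype.card Fq = p ^ f) : CharP Fq p := by
  have := Fact.mk hp
  exact charP_of_card_eq_prime_pow hcard

theorem sum_pow_all (Fq : Type) [Field Fq] [Fintype Fq] {i : ℕ} (hi : 0 < i) :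
    ∑ a : Fq, a ^ i = if (Fintype.card Fq - 1) ∣ i then -1 else 0 := by
  classical
  rw [← FiniteField.sum_pow_units Fq i]
  have := Finset.sum_subset (s₁ := Finset.univ.erase (0 : Fq)) (s₂ := Finset.univ) (f := fun a => a ^ i)
    (Finset.subset_univ _) (by intro x _ hx; simp at hx; simp [hx, hi.ne'])
  rw [← this]
  symm
  apply Finset.sum_bij (fun (u : Fqˣ) _ => (u : Fq))
  · intro a _; simp
  · intro a _ b _ h; exact Units.ext h
  · intro b hb
    simp at hb
    exact ⟨Units.mk0 b hb, Finset.mem_univ _, rfl⟩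
  · intro a _; simp

/-- coefficient in the recursion -/
noncomputable def RR (Fq : Type) [Field Fq] [Fintype Fq] (n m : ℕ) : Fq :=
  (n.choose m : Fq) * ∑ a : Fq, a ^ (n - m)

theorem RR_ne (Fq : Type) [Field Fq] [Fintype Fq] {p f : ℕ} (hp : p.Prime) 
    (hcard : Fintype.card Fq = p ^ f) (n m : ℕ) : RR Fq n m ≠ 0 ↔ Step p (p ^ f) n m := by
  have := charP_of Fq hp hcard
  unfold RR Step
  rw [mul_ne_zero_iff, Ne, CharP.cast_eq_zero_iff Fq p, lucas_DL hp]
  by_cases hmn : m < n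
  · rw [sum_pow_all Fq (by omega), hcard]
    by_cases hd : (p ^ f - 1) ∣ (n - m) <;> simp [hd, hmn]
  · have : n - m = 0 := by omega
    simp [this, hmn]

theorem powerSum_zero (Fq : Type) [Field Fq] [Fintype Fq] (n : ℕ) : powerSum Fq 0 n = 1 := by
  simp [powerSum]

theorem powerSum_succ (Fq : Type) [Field Fq] [Fintype Fq] (d n : ℕ) :
    powerSum Fq (d + 1) n =
      ∑ m ∈ Finset.range (n + 1), C (RR Fq n m) * (X ^ m * powerSum Fq d m) := by
  unfold powerSum
  rw [← (Fin.consEquiv (fun _ : Fin (d + 1) => Fq)).sum_comp, Fintype.sum_prod_type]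
  have h1 : ∀ (a : Fq) (c : Fin d → Fq), 
     (X ^ (d + 1) + ∑ i : Fin (d + 1), C ((Fin.consEquiv (fun _ : Fin (d + 1) => Fq)) (a, c) i) * X ^ (i : ℕ)) ^ n
     = ∑ m ∈ Finset.range (n + 1), (X ^ m * (X ^ d + ∑ i : Fin d, C (c i) * X ^ (i : ℕ)) ^ m) *
         (C ((n.choose m : Fq) * a ^ (n - m))) := by
    intro a c
    have : (X ^ (d + 1) + ∑ i : Fin (d + 1), C ((Fin.consEquiv (fun _ : Fin (d + 1) => Fq)) (a, c) i) * X ^ (i : ℕ))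
       = X * (X ^ d + ∑ i : Fin d, C (c i) * X ^ (i : ℕ)) + C a := by
      rw [Fin.sum_univ_succ]
      simp only [Fin.consEquiv_apply, Fin.cons_zero, Fin.cons_succ, Fin.val_zero, Fin.val_succ, pow_zero, mul_one, mul_add, Finset.mul_sum]
      have : ∀ i : Fin d, (C (c i) * X ^ ((i : ℕ) + 1) : Fq[X]) = X * (C (c i) * X ^ (i : ℕ)) := by
        intro i; ring
      simp only [this]
      ring
    rw [this, add_pow]
    apply Finset.sum_congr rfl
    intro m _
    rw [mul_pow]
    simp only [C_mul, C_pow, C_eq_natCast, map_natCast]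
    ring
  simp only [h1]
  simp_rw [Finset.sum_comm (t := Finset.range (n + 1))]
  apply Finset.sum_congr rfl
  intro m _
  simp_rw [← Finset.sum_mul, ← Finset.mul_sum]
  rw [RR, mul_comm, ← map_sum, ← Finset.mul_sum, Finset.mul_sum]

end

/-- weights of chains -/
def WW (p q : ℕ) : ℕ → ℕ → ℕ → Prop
  | 0, _, w => w = 0
  | d + 1, n, w => ∃ m w', Step p q n m ∧ WW p q d m w' ∧ w = m + w'

theorem WW_iff (p q d n w : ℕ) : WW p q d n w ↔
    ∃ c, IsChain p q d n c ∧ ∑ j ∈ Finset.range d, c (j + 1) = w := by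
  induction d generalizing n w with
  | zero =>
    simp only [WW, Finset.range_zero, Finset.sum_empty]
    constructor
    · intro h; exact ⟨fun _ => n, ⟨rfl, by intro j hj; omega⟩, h.symm⟩
    · rintro ⟨c, _, h⟩; exact h.symm
  | succ d ih =>
    simp only [WW]
    constructor
    · rintro ⟨m, w', hs, hw, rfl⟩
      obtain ⟨c, hc, hcw⟩ := (ih m w').mp hw
      refine ⟨fun j => if j = 0 then n else c (j - 1), ⟨by simp, ?_⟩, ?_⟩
      · intro j hj
        rcases j with _ | j
        · simpa [hc.1] using hs
        · simpa using hc.2 j (by omega)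
      · rw [Finset.sum_range_succ']
        simp [hcw, hc.1, add_comm]
    · rintro ⟨c, hc, rfl⟩
      refine ⟨c 1, ∑ j ∈ Finset.range d, c (j + 2), ?_, (ih _ _).mpr ⟨fun j => c (j + 1), ⟨rfl, ?_⟩, rfl⟩, ?_⟩
      · have := hc.2 0 (by omega)
        rwa [hc.1] at this
      · intro j hj; exact hc.2 (j + 1) (by omega)
      · rw [Finset.sum_range_succ', add_comm]

theorem WW_min_unique {p f : ℕ} (hf : 0 < f) (hp : 2 ≤ p) {d n m m' w' wb : ℕ}
    (h1 : Step p (p ^ f) n m) (h2 : WW p (p ^ f) d m w')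
    (h1' : Step p (p ^ f) n m') (h2' : WW p (p ^ f) d m' wb)
    (he : m + w' = m' + wb) (hmin : ∀ w, WW p (p ^ f) (d + 1) n w → m + w' ≤ w) : m = m' := by
  have aux : ∀ m w', Step p (p ^ f) n m → WW p (p ^ f) d m w' →
      ∃ c, IsChain p (p ^ f) (d + 1) n c ∧ c 1 = m ∧ ∑ j ∈ Finset.range (d + 1), c (j + 1) = m + w' := by
    intro m w' hs hw
    obtain ⟨c, hc, hcw⟩ := (WW_iff _ _ _ _ _).mp hw
    refine ⟨fun j => if j = 0 then n else c (j - 1), ⟨by simp, ?_⟩, ?_, ?_⟩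
    · intro j hj
      rcases j with _ | j
      · simpa [hc.1] using hs
      · simpa using hc.2 j (by omega)
    · simp [hc.1]
    · rw [Finset.sum_range_succ']
      simp [hcw, hc.1, add_comm]
  obtain ⟨c, hc, hc1, hcs⟩ := aux m w' h1 h2
  obtain ⟨c', hc', hc1', hcs'⟩ := aux m' wb h1' h2'
  have hb : ∀ b, IsChain p (p ^ f) (d + 1) n b → m + w' ≤ ∑ j ∈ Finset.range (d + 1), b (j + 1) :=
    fun b hb => hmin _ ((WW_iff _ _ _ _ _).mpr ⟨b, hb, rfl⟩)
  have := chain_min_unique hf hp hc hc' (fun b h => hcs ▸ hb b h) (fun b h => by rw [hcs', ← he]; exact hb b h)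
  rw [← hc1, ← hc1', this]

theorem coeff_succ (Fq : Type) [Field Fq] [Fintype Fq] (d n w : ℕ) :
    (powerSum Fq (d + 1) n).coeff w = ∑ m ∈ Finset.range (n + 1),
      RR Fq n m * (if m ≤ w then (powerSum Fq d m).coeff (w - m) else 0) := by
  rw [powerSum_succ, finsetSum_coeff]
  apply Finset.sum_congr rfl
  intro m _
  rw [coeff_C_mul, coeff_X_pow_mul']

theorem lemA (Fq : Type) [Field Fq] [Fintype Fq] {p f : ℕ} (hp : p.Prime)
    (hcard : Fintype.card Fq = p ^ f) (d n w : ℕ) (h : (powerSum Fq d n).coeff w ≠ 0) :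
    WW p (p ^ f) d n w := by
  induction d generalizing n w with
  | zero =>
    rw [powerSum_zero, coeff_one] at h
    simp only [WW]
    by_contra h'
    simp [h'] at h
  | succ d ih =>
    rw [coeff_succ] at h
    obtain ⟨m, _, hm⟩ := Finset.exists_ne_zero_of_sum_ne_zero h
    obtain ⟨h1, h2⟩ := mul_ne_zero_iff.mp hm
    split_ifs at h2 with hle
    · exact ⟨m, w - m, (RR_ne Fq hp hcard n m).mp h1, ih _ _ h2, by omega⟩
    · exact absurd rfl h2

theorem lemB (Fq : Type) [Field Fq] [Fintype Fq] {p f : ℕ} (hp : p.Prime) (hf : 0 < f)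
    (hcard : Fintype.card Fq = p ^ f) (d n w : ℕ) (h : WW p (p ^ f) d n w)
    (hmin : ∀ w', WW p (p ^ f) d n w' → w ≤ w') : (powerSum Fq d n).coeff w ≠ 0 := by
  induction d generalizing n w with
  | zero =>
    simp only [WW] at h
    simp [powerSum_zero, h]
  | succ d ih =>
    obtain ⟨m, w', hs, hw, rfl⟩ := h
    rw [coeff_succ, Finset.sum_eq_single m]
    · rw [if_pos (by omega)]
      refine mul_ne_zero ((RR_ne Fq hp hcard n m).mpr hs) ?_
      rw [Nat.add_sub_cancel_left]
      refine ih _ _ hw ?_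
      intro wb hwb
      have := hmin _ ⟨m, wb, hs, hwb, rfl⟩
      omega
    · intro m' _ hne
      by_contra hm
      obtain ⟨h1, h2⟩ := mul_ne_zero_iff.mp hm
      split_ifs at h2 with hle
      · exact hne (WW_min_unique hf hp.two_le ((RR_ne Fq hp hcard n m').mp h1) (lemA Fq hp hcard _ _ _ h2)
          hs hw (by omega) (by intro w hw; have := hmin _ hw; omega))
      · exact absurd rfl h2
    · intro hm
      exact absurd (Finset.mem_range.mpr (by have := hs.1; omega)) hm

theorem WW_le {p q d n w : ℕ} (h : WW p q d n w) : d ≤ n := by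
  induction d generalizing n w with
  | zero => omega
  | succ d ih =>
    obtain ⟨m, w', hs, hw, rfl⟩ := h
    have := ih hw
    have := hs.1
    omega

theorem Step.trans {p q a b c : ℕ} (h : Step p q a b) (h' : Step p q b c) : Step p q a c := by
  refine ⟨h'.1.trans h.1, ?_, fun e => (h'.2.2 e).trans (h.2.2 e)⟩
  have : a - c = (a - b) + (b - c) := by have := h.1; have := h'.1; omega
  rw [this]
  exact dvd_add h.2.1 h'.2.1

theorem WW_drop {p q d n w : ℕ} (h : WW p q (d + 2) n w) : ∃ w' < w, WW p q (d + 1) n w' := by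
  obtain ⟨m, w', hs, ⟨m', wb, hs', hw, rfl⟩, rfl⟩ := h
  refine ⟨m' + wb, ?_, m', wb, hs.trans hs', hw, rfl⟩
  have := hs'.1
  omega

theorem WW_drop_zero {p q n w : ℕ} (h : WW p q 0 n w) : w = 0 := h

open Classical in
/-- minimal weight -/
noncomputable def mu (p q d n : ℕ) : ℕ := sInf {w | WW p q d n w}

theorem mu_le {p q d n w : ℕ} (h : WW p q d n w) : mu p q d n ≤ w := Nat.sInf_le h

theorem mu_mem {p q d n w : ℕ} (h : WW p q d n w) : WW p q d n (mu p q d n) :=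
  Nat.sInf_mem (s := {w | WW p q d n w}) ⟨w, h⟩

theorem mu_lt {p q a b n w : ℕ} (ha : 1 ≤ a) (hab : a < b) (h : WW p q b n w) :
    mu p q a n < w := by
  induction b, hab using Nat.le_induction generalizing w with
  | base =>
    obtain ⟨d, rfl⟩ : ∃ d, a = d + 1 := ⟨a - 1, by omega⟩
    obtain ⟨w', h1, h2⟩ := WW_drop h
    exact (mu_le h2).trans_lt h1
  | succ b hb ih =>
    obtain ⟨d, rfl⟩ : ∃ d, b = d + 1 := ⟨b - 1, by omega⟩
    obtain ⟨w', h1, h2⟩ := WW_drop h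
    exact (ih h2).trans h1

theorem X_pow_dvd_ps (Fq : Type) [Field Fq] [Fintype Fq] {p f : ℕ} (hp : p.Prime)
    (hcard : Fintype.card Fq = p ^ f) {a b n : ℕ} (hab : a ≤ b) (h0 : 1 ≤ a ∨ a = b ∨ a = 0) :
    X ^ mu p (p ^ f) a n ∣ powerSum Fq b n := by
  rw [X_pow_dvd_iff]
  intro w hw
  by_contra h
  have hW := lemA Fq hp hcard _ _ _ h
  rcases eq_or_lt_of_le hab with rfl | hlt
  · exact absurd (mu_le hW) (by omega)
  · rcases h0 with h0 | h0 | h0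
    · exact absurd (mu_lt h0 hlt hW) (by omega)
    · omega
    · subst h0
      have : mu p (p ^ f) 0 n ≤ 0 := mu_le rfl
      omega

theorem X_pow_dvd_ps_strict (Fq : Type) [Field Fq] [Fintype Fq] {p f : ℕ} (hp : p.Prime)
    (hcard : Fintype.card Fq = p ^ f) {a b n : ℕ} (ha : 1 ≤ a) (hab : a < b) :
    X ^ (mu p (p ^ f) a n + 1) ∣ powerSum Fq b n := by
  rw [X_pow_dvd_iff]
  intro w hw
  by_contra h
  exact absurd (mu_lt ha hab (lemA Fq hp hcard _ _ _ h)) (by omega)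

theorem ps_eq_zero (Fq : Type) [Field Fq] [Fintype Fq] {p f : ℕ} (hp : p.Prime)
    (hcard : Fintype.card Fq = p ^ f) {d n : ℕ} (h : ¬ ∃ w, WW p (p ^ f) d n w) :
    powerSum Fq d n = 0 := by
  ext w
  by_contra hc
  exact h ⟨w, lemA Fq hp hcard _ _ _ (by simpa using hc)⟩

theorem WW_Lval {p f : ℕ} (hp : 2 ≤ p) (hf : 0 < f) (d n : ℕ) :
    (∃ w, WW p (p ^ f) d n w) ↔ (d : ℚ) ≤ Lval p f n hf := by
  have hL : (d : ℚ) ≤ Lval p f n hf ↔ ∀ i ∈ Finset.range f,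
      (d : ℚ) ≤ ((Nat.digits (p ^ f) (n * p ^ i)).sum : ℚ) / ((p : ℚ) ^ f - 1) :=
    Finset.le_inf'_iff _ _
  rw [hL, ← chain_iff_L p f hp hf n d]
  constructor
  · rintro ⟨w, h⟩
    obtain ⟨c, hc, _⟩ := (WW_iff _ _ _ _ _).mp h
    exact ⟨c, hc⟩
  · rintro ⟨c, hc⟩
    exact ⟨_, (WW_iff _ _ _ _ _).mpr ⟨c, hc, rfl⟩⟩

theorem anti_ge {r : ℕ} {dt : Fin r → ℕ} (h : StrictAnti dt) (i : Fin r) : r - 1 - (i : ℕ) ≤ dt i := by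
  obtain ⟨j, hj⟩ : ∃ j, j = r - 1 - (i : ℕ) := ⟨_, rfl⟩
  induction j generalizing i with
  | zero => omega
  | succ j ih =>
    have h1 := ih ⟨i + 1, by omega⟩ (by simp only; omega)
    have h2 : dt ⟨i + 1, by omega⟩ < dt i := h (by rw [Fin.lt_def]; simp)
    simp only at h1
    omega

theorem mz_sum (Fq : Type) [Field Fq] [Fintype Fq] {p f : ℕ} (hp : p.Prime)
    (hcard : Fintype.card Fq = p ^ f) {r : ℕ} (k : Fin r → ℕ) :
    ∃ S : Finset (Fin r → ℕ), (∀ dt ∈ S, StrictAnti dt) ∧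
      (∀ dt, StrictAnti dt → dt ∉ S → ∏ i, powerSum Fq (dt i) (k i) = 0) ∧
      multizeta Fq k = ∑ dt ∈ S, ∏ i, powerSum Fq (dt i) (k i) := by
  classical
  refine ⟨(Finset.Icc 0 k).filter StrictAnti, ?_, ?_, ?_⟩
  · intro dt h; exact (Finset.mem_filter.mp h).2
  · intro dt ha h
    have : ¬ dt ≤ k := fun hle => h (Finset.mem_filter.mpr ⟨Finset.mem_Icc.mpr ⟨fun i => Nat.zero_le _, hle⟩, ha⟩)
    rw [Pi.le_def] at this
    push Not at this
    obtain ⟨i, hi⟩ := this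
    refine Finset.prod_eq_zero (Finset.mem_univ i) (ps_eq_zero Fq hp hcard ?_)
    rintro ⟨w, hw⟩
    have := WW_le hw
    omega
  · unfold multizeta
    simp_rw [finsum_eq_if]
    rw [finsum_eq_sum_of_support_subset (s := Finset.Icc 0 k), Finset.sum_filter]
    intro dt hdt
    rw [Function.mem_support] at hdt
    split_ifs at hdt with ha
    · rw [Finset.prod_ne_zero_iff] at hdt
      rw [Finset.mem_coe, Finset.mem_Icc]
      refine ⟨fun i => Nat.zero_le _, fun i => ?_⟩
      by_contra hc
      have hc' : ¬ dt i ≤ k i := hc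
      refine hdt i (Finset.mem_univ i) (ps_eq_zero Fq hp hcard ?_)
      rintro ⟨w, hw⟩
      have := WW_le hw
      omega
    · exact absurd rfl hdt

theorem coeff_prod_min {Fq : Type} [Field Fq] {r : ℕ} (P : Fin r → Fq[X]) (t : Fin r → ℕ)
    (h1 : ∀ i, X ^ t i ∣ P i) (h2 : ∀ i, (P i).coeff (t i) ≠ 0) :
    (∏ i, P i).coeff (∑ i, t i) ≠ 0 := by
  choose Q hQ using h1
  have : ∏ i, P i = (∏ i, Q i) * X ^ (∑ i, t i) := by
    rw [← Finset.prod_pow_eq_pow_sum, ← Finset.prod_mul_distrib]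
    apply Finset.prod_congr rfl
    intro i _
    rw [hQ i, mul_comm]
  rw [this, coeff_mul_X_pow', if_pos le_rfl, Nat.sub_self, coeff_zero_prod, Finset.prod_ne_zero_iff]
  intro i _
  have := h2 i
  rw [hQ i, coeff_X_pow_mul', if_pos le_rfl, Nat.sub_self] at this
  exact this

end MZ

theorem multizeta_eq_zero_iff_trivial
    (p f : ℕ) (hp : p.Prime) (hf : 0 < f)
    (Fq : Type) [Field Fq] [Fintype Fq] (hcard : Fintype.card Fq = p ^ f)
    (r : ℕ) (hr : 1 < r) (k : Fin r → ℕ) (hk : ∀ i, 0 < k i) :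
    multizeta Fq k = 0 ↔
      ∃ i : Fin r, (i : ℕ) + 1 < r ∧ Lval p f (k i) hf < (r : ℚ) - (i : ℚ) - 1 := by
  have hcast : ∀ i : Fin r, (r : ℚ) - (i : ℚ) - 1 = ((r - 1 - (i : ℕ) : ℕ) : ℚ) := by
    intro i
    have : r = (r - 1 - (i : ℕ)) + (i : ℕ) + 1 := by omega
    have h2 : (r : ℚ) = ((r - 1 - (i : ℕ) : ℕ) : ℚ) + (i : ℕ) + 1 := by exact_mod_cast this
    linarith
  obtain ⟨S, hS1, hS2, hS⟩ := MZ.mz_sum Fq hp hcard k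
  constructor
  · intro hz
    by_contra hne
    push Not at hne
    have hW : ∀ i : Fin r, ∃ w, MZ.WW p (p ^ f) (r - 1 - (i : ℕ)) (k i) w := by
      intro i
      by_cases hi : (i : ℕ) + 1 < r
      · rw [MZ.WW_Lval hp.two_le hf, ← hcast]
        exact hne i hi
      · have : r - 1 - (i : ℕ) = 0 := by omega
        rw [this]
        exact ⟨0, rfl⟩
    set d0 : Fin r → ℕ := fun i => r - 1 - (i : ℕ) with hd0
    have hd0a : StrictAnti d0 := by
      intro i j hij
      simp only [hd0]
      rw [Fin.lt_def] at hij
      omega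
    have hc0 : (∏ i, powerSum Fq (d0 i) (k i)).coeff (∑ i, MZ.mu p (p ^ f) (d0 i) (k i)) ≠ 0 := by
      apply MZ.coeff_prod_min
      · intro i
        exact MZ.X_pow_dvd_ps Fq hp hcard le_rfl (Or.inr (Or.inl rfl))
      · intro i
        obtain ⟨w, hw⟩ := hW i
        exact MZ.lemB Fq hp hf hcard _ _ _ (MZ.mu_mem hw) (fun w' h => MZ.mu_le h)
    have hmem : d0 ∈ S := by
      by_contra h
      rw [hS2 d0 hd0a h] at hc0
      simp at hc0
    apply hc0
    have hz' := hz
    rw [hS] at hz'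
    have hz2 := congrArg (fun P => P.coeff (∑ i, MZ.mu p (p ^ f) (d0 i) (k i))) hz'
    simp only [finsetSum_coeff, coeff_zero] at hz2
    rw [Finset.sum_eq_single d0] at hz2
    · exact hz2
    · intro dt hdt hdne
      have ha := hS1 dt hdt
      have hge : ∀ i, d0 i ≤ dt i := MZ.anti_ge ha
      by_cases hall : ∃ i : Fin r, (i : ℕ) + 1 < r ∧ d0 i < dt i
      · obtain ⟨i, hi, hlt⟩ := hall
        have hdvd : X ^ (∑ i, MZ.mu p (p ^ f) (d0 i) (k i) + 1) ∣ ∏ i, powerSum Fq (dt i) (k i) := by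
          rw [← Finset.mul_prod_erase _ _ (Finset.mem_univ i), ← Finset.add_sum_erase _ _ (Finset.mem_univ i),
            add_right_comm, pow_add]
          refine mul_dvd_mul (MZ.X_pow_dvd_ps_strict Fq hp hcard (by simp only [hd0]; omega) hlt) ?_
          rw [← Finset.prod_pow_eq_pow_sum]
          refine Finset.prod_dvd_prod_of_dvd _ _ ?_
          intro j _
          exact MZ.X_pow_dvd_ps Fq hp hcard (hge j) (by omega)
        exact (X_pow_dvd_iff.mp hdvd) _ (Nat.lt_succ_self _)
      · exfalso
        push Not at hall
        apply hdne
        funext i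
        by_cases hi : (i : ℕ) + 1 < r
        · exact le_antisymm (hall i hi) (hge i)
        · have h1 := hall ⟨r - 2, by omega⟩ (by simp only; omega)
          have h2 : dt i < dt ⟨r - 2, by omega⟩ := ha (by rw [Fin.lt_def]; simp only; omega)
          simp only [hd0] at h1 ⊢
          omega
    · intro h; exact absurd hmem h
  · rintro ⟨i, hi, hL⟩
    rw [hS]
    apply Finset.sum_eq_zero
    intro dt hdt
    refine Finset.prod_eq_zero (Finset.mem_univ i) (MZ.ps_eq_zero Fq hp hcard ?_)
    rw [MZ.WW_Lval hp.two_le hf]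
    have := MZ.anti_ge (hS1 dt hdt) i
    rw [hcast] at hL
    have : ((r - 1 - (i : ℕ) : ℕ) : ℚ) ≤ dt i := by exact_mod_cast this
    linarith
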